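/- arXiv:2208.02535 — 2 statements merged into one kernel-verified Lean document; each statement's English description precedes it below -/
import Mathlib

section
/- Let p be a prime number, n < p-1 a natural number, and (A,+) an abelian group of cardinality p^n. Let j ≥ 2, let W be a non-associative word in variables X_1,…,X_j in which each X_i occurs exactly once and the variables occur in the order X_1,…,X_j, and let i_1,…,i_{j−1} > 0 and i_j ≥ 0 be natural numbers. Let V_j be the set of non-associative words of length greater than 2 in X_1,…,X_j in which X_j occurs exactly once, at the end. Then there exist integers β_v for v ∈ V_j, only finitely many of them nonzero, depending only on (A,+), W and i_1,…,i_j (not on the brace multiplication), such that for every brace (A,+,∘) with additive group (A,+) and all x_1,…,x_j ∈ A: [℘^{-1}(W{p^{i_1}x_1, …, p^{i_j}x_j})] = p^{i_1+⋯+i_j−1}·W⟨[x_1],…,[x_j]⟩ + p^{i_1+⋯+i_j}·Σ_{v∈V_j} β_v·v⟨[x_1],…,[x_j]⟩ in A/ann(p^2), where W{y_1,…,y_j} denotes the evaluation of W at X_i = y_i under the operation *, and w⟨[x_1],…,[x_j]⟩ denotes the evaluation of a word w at X_i = [x_i] under the operation ⊙. -/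
universe u

/-- A left brace: `(A,+)` abelian group, `(A,∘)` a group, with
`a∘(b+c)+a = a∘b+a∘c`. -/
structure LeftBrace (A : Type u) [AddCommGroup A] where
  circ : A → A → A
  one : A
  inv : A → A
  circ_assoc : ∀ a b c : A, circ (circ a b) c = circ a (circ b c)
  one_circ : ∀ a : A, circ one a = a
  circ_one : ∀ a : A, circ a one = a
  inv_circ : ∀ a : A, circ (inv a) a = one
  circ_add : ∀ a b c : A, circ a (b + c) + a = circ a b + circ a c

/-- `a*b = a∘b - a - b`. -/
def LeftBrace.star {A : Type u} [AddCommGroup A] (B : LeftBrace A) (a b : A) : A :=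
  B.circ a b - a - b

/-- `ann(k) = {a : k•a = 0}`, as an additive subgroup. -/
def annSub (A : Type u) [AddCommGroup A] (k : ℕ) : AddSubgroup A where
  carrier := {a : A | k • a = 0}
  zero_mem' := by simp
  add_mem' := by
    intro a b ha hb
    have ha' : k • a = 0 := ha
    have hb' : k • b = 0 := hb
    show k • (a + b) = 0
    rw [smul_add, ha', hb', add_zero]
  neg_mem' := by
    intro a ha
    have ha' : k • a = 0 := ha
    show k • (-a) = 0
    rw [smul_neg, ha', neg_zero]

/-- The coset `[a]` of `a` in `A/ann(k)`. -/
def qmk {A : Type u} [AddCommGroup A] (k : ℕ) (a : A) : A ⧸ annSub A k :=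
  QuotientAddGroup.mk a

/-- Evaluation of a non-associative word under a binary operation `op`,
substituting `f i` for the variable `i`. -/
def wEval {α : Type*} {β : Type*} (op : β → β → β) (f : α → β) : FreeMagma α → β
  | FreeMagma.of a => f a
  | FreeMagma.mul x y => op (wEval op f x) (wEval op f y)

/-- The list of leaves (occurrences of variables, left to right) of a word. -/
def wLeaves {α : Type*} : FreeMagma α → List α
  | FreeMagma.of a => [a]
  | FreeMagma.mul x y => wLeaves x ++ wLeaves y

/-- The last (rightmost) variable of a word. -/
def wLast {α : Type*} : FreeMagma α → α
  | FreeMagma.of a => a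
  | FreeMagma.mul _ y => wLast y

/-- The number of occurrences of the variable `a` in a word. -/
def wCount {α : Type*} [DecidableEq α] (a : α) : FreeMagma α → ℕ
  | FreeMagma.of b => if b = a then 1 else 0
  | FreeMagma.mul x y => wCount a x + wCount a y

/-- The length (number of variable occurrences) of a word. -/
def wLen {α : Type*} : FreeMagma α → ℕ
  | FreeMagma.of _ => 1
  | FreeMagma.mul x y => wLen x + wLen y

/-- Left-normed product `a₁·(a₂·(⋯(aₘ·b)⋯))`. -/
def leftProd {Q : Type*} (mul : Q → Q → Q) : List Q → Q → Q
  | [], b => b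
  | a :: l, b => mul a (leftProd mul l b)

/-- `circPow B a k` is the product of `k` copies of `a` under `∘`. -/
def circPow {A : Type u} [AddCommGroup A] (B : LeftBrace A) (a : A) : ℕ → A
  | 0 => B.one
  | k + 1 => B.circ a (circPow B a k)

/-- `eSeq B a (i-1)` is `a_i`, where `a_1 = a` and `a_{i+1} = a * a_i`. -/
def eSeq {A : Type u} [AddCommGroup A] (B : LeftBrace A) (a : A) : ℕ → A
  | 0 => a
  | i + 1 => B.star a (eSeq B a i)

/-- `starIter B a b (i-1)` is `e_i`, where `e_1 = a*b` and `e_{i+1} = a*e_i`. -/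
def starIter {A : Type u} [AddCommGroup A] (B : LeftBrace A) (a b : A) : ℕ → A
  | 0 => B.star a b
  | i + 1 => B.star a (starIter B a b i)

/-- `iterOp op u v i` is `u ⊙ (u ⊙ (⋯ (u ⊙ v)))` with `i` applications of `u ⊙ ·`. -/
def iterOp {Q : Type*} (op : Q → Q → Q) (u v : Q) : ℕ → Q
  | 0 => v
  | i + 1 => op u (iterOp op u v i)

/-- `f(a) = Σ_{i=1}^{p−1} (C(p−1,i−1)/i)·e_i` where `e_1 = a`, `e_{i+1} = a*e_i`. -/
def fMap {A : Type u} [AddCommGroup A] (B : LeftBrace A) (p : ℕ) (a : A) : A :=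
  ∑ i ∈ Finset.Icc 1 (p - 1), (Nat.choose (p - 1) (i - 1) / i) • eSeq B a (i - 1)

/-- `braceChainAux B (i-1)` is `A^i`: `A^1 = A`, `A^{i+1}` the additive subgroup
generated by `{x*y : x ∈ A, y ∈ A^i}`. -/
def braceChainAux {A : Type u} [AddCommGroup A] (B : LeftBrace A) : ℕ → AddSubgroup A
  | 0 => ⊤
  | i + 1 => AddSubgroup.closure {z : A | ∃ x : A, ∃ y ∈ braceChainAux B i, z = B.star x y}

/-- `dSeq B a b i = (d_i, d_i')`: `d_0 = a`, `d_0' = b`, `d_{i+1} = d_i + d_i'`,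
`d_{i+1}' = d_i * d_i'`. -/
def dSeq {A : Type u} [AddCommGroup A] (B : LeftBrace A) (a b : A) : ℕ → A × A
  | 0 => (a, b)
  | i + 1 => ((dSeq B a b i).1 + (dSeq B a b i).2, B.star (dSeq B a b i).1 (dSeq B a b i).2)

theorem span_ind_tors {Q : Type*} [AddCommGroup Q] (N : ℕ) (hN : 0 < N)
    (htor : ∀ q : Q, N • q = 0) (Y : Set Q) (P : Q → Prop)
    (hY : ∀ y ∈ Y, P y) (h0 : P 0) (hadd : ∀ a b, P a → P b → P (a + b)) :
    ∀ q ∈ Submodule.span ℤ Y, P q := by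
  intro q hq
  have hnat : ∀ (k : ℕ) (a : Q), P a → P (k • a) := by
    intro k a ha
    induction k with
    | zero => simpa using h0
    | succ k ih => rw [succ_nsmul]; exact hadd _ _ ih ha
  induction hq using Submodule.span_induction with
  | mem x h => exact hY x h
  | zero => exact h0
  | add x y _ _ hx hy => exact hadd _ _ hx hy
  | smul z x _ hx =>
    have h1 : z • x = (z % (N : ℤ)).toNat • x := by
      have h2 : (((z % (N : ℤ)).toNat : ℕ) : ℤ) = z % N :=
        Int.toNat_of_nonneg (Int.emod_nonneg _ (by omega))
      have h3 : ((z % (N : ℤ)).toNat • x : Q) = (z % (N : ℤ)) • x := by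
        rw [← natCast_zsmul, h2]
      rw [h3]
      conv_lhs => rw [← Int.emod_add_mul_ediv z N]
      rw [add_smul, mul_comm, mul_smul, natCast_zsmul, htor, smul_zero, add_zero]
    rw [h1]
    exact hnat _ _ hx

/-- `p^s N` as a submodule. -/
def PS {E : Type*} [AddCommGroup E] (p s : ℕ) (N : Submodule ℤ E) : Submodule ℤ E :=
  N.map (LinearMap.lsmul ℤ E ((p : ℤ) ^ s))

theorem mem_PS {E : Type*} [AddCommGroup E] {p s : ℕ} {N : Submodule ℤ E} {e : E} :
    e ∈ PS p s N ↔ ∃ y ∈ N, e = (p ^ s) • y := by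
  unfold PS
  rw [Submodule.mem_map]
  constructor
  · rintro ⟨y, hy, rfl⟩
    refine ⟨y, hy, ?_⟩
    rw [LinearMap.lsmul_apply, ← natCast_zsmul]; push_cast; rfl
  · rintro ⟨y, hy, rfl⟩
    refine ⟨y, hy, ?_⟩
    rw [LinearMap.lsmul_apply, ← natCast_zsmul]; push_cast; rfl

theorem PS_anti {E : Type*} [AddCommGroup E] {p s t : ℕ} (h : s ≤ t) {N N' : Submodule ℤ E}
    (hN : N ≤ N') : PS p t N ≤ PS p s N' := by
  intro e he
  obtain ⟨y, hy, rfl⟩ := mem_PS.1 he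
  refine mem_PS.2 ⟨p ^ (t - s) • y, N'.nsmul_mem (hN hy) _, ?_⟩
  rw [smul_smul, ← pow_add]; congr 2; omega

theorem inv_exists {Q : Type*} [AddCommGroup Q] (p n : ℕ) (htor : ∀ q : Q, p ^ n • q = 0)
    (AA : Submodule ℤ (Module.End ℤ Q)) (hmul : ∀ a ∈ AA, ∀ b ∈ AA, a * b ∈ AA)
    (T : Module.End ℤ Q) (hT : T ∈ AA) :
    ∃ R ∈ AA, (1 + p • T) * (1 + R) = 1 := by
  have key : ∀ k : ℕ, ∃ R ∈ AA, ∃ U ∈ AA, (1 + p • T) * (1 + R) = 1 + p ^ k • U := by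
    intro k
    induction k with
    | zero => exact ⟨0, AA.zero_mem, p • T, AA.nsmul_mem hT _, by simp⟩
    | succ k ih =>
      obtain ⟨R, hR, U, hU, h⟩ := ih
      refine ⟨-(p • T) - (p • T) * R, AA.sub_mem (AA.neg_mem (AA.nsmul_mem hT _))
        (hmul _ (AA.nsmul_mem hT _) _ hR), -(T * U), AA.neg_mem (hmul _ hT _ hU), ?_⟩
      have e1 : (1 + p • T) * (1 + (-(p • T) - (p • T) * R))
          = 1 + p • T - (p • T) * ((1 + p • T) * (1 + R)) := by
        generalize p • T = Z
        noncomm_ring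
      rw [e1, h, mul_add, mul_one, mul_smul_comm, smul_mul_assoc, smul_smul, ← pow_succ, smul_neg]
      abel
  obtain ⟨R, hR, U, hU, h⟩ := key n
  refine ⟨R, hR, ?_⟩
  rw [h]
  have : p ^ n • U = 0 := by ext q; exact htor (U q)
  rw [this, add_zero]

theorem geom_choose {R : Type*} [Ring R] (t : R) (m : ℕ) :
    ∑ k ∈ Finset.range m, (1 + t) ^ k
      = ∑ k ∈ Finset.range m, (m.choose (k + 1)) • t ^ k := by
  have h := Polynomial.geom_sum_X_comp_X_add_one_eq_sum (R := ℤ) m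
  have h2 := congrArg (Polynomial.aeval t) h
  simp only [Polynomial.comp, Polynomial.eval₂_finsetSum, map_sum, Polynomial.eval₂_pow,
    Polynomial.eval₂_X, map_pow, map_add, Polynomial.aeval_X, map_one, map_mul, map_natCast] at h2
  simp only [add_comm (1 : R) t, nsmul_eq_mul]
  exact h2

theorem choose_dvd {p : ℕ} (hp : p.Prime) (s k : ℕ) (hk : k + 1 < p) :
    p ^ s ∣ (p ^ s).choose (k + 1) := by
  have h : p ^ s ∣ (p ^ s).choose (k + 1) * (k + 1) := by
    obtain ⟨m, hm⟩ : ∃ m, p ^ s = m + 1 :=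
      ⟨p ^ s - 1, by have := pow_pos hp.pos s; omega⟩
    rw [hm, ← Nat.add_one_mul_choose_eq]
    exact dvd_mul_right _ _
  refine Nat.Coprime.dvd_of_dvd_mul_right ?_ h
  exact Nat.Coprime.pow_left _ ((Nat.Prime.coprime_iff_not_dvd hp).2
    (fun hd => by have := Nat.le_of_dvd (by omega) hd; omega))

/-- the geometric sum is `p^s + p^(s+1) U`. -/
theorem geom_exists {Q : Type*} [AddCommGroup Q] (p n : ℕ) (hp : p.Prime) (hn : n ≤ p - 1)
    (htor : ∀ q : Q, p ^ n • q = 0)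
    (AA : Submodule ℤ (Module.End ℤ Q)) (hmul : ∀ a ∈ AA, ∀ b ∈ AA, a * b ∈ AA)
    (T : Module.End ℤ Q) (hT : T ∈ AA) (s : ℕ) :
    ∃ U ∈ AA, ∑ k ∈ Finset.range (p ^ s), (1 + p • T) ^ k = p ^ s • 1 + p ^ (s + 1) • U := by
  have hpow : ∀ k, T ^ (k + 1) ∈ AA := by
    intro k
    induction k with
    | zero => simpa using hT
    | succ k ih => rw [pow_succ]; exact hmul _ ih _ hT
  have hterm : ∀ k, ∃ U ∈ AA, ((p ^ s).choose (k + 1 + 1)) • (p • T) ^ (k + 1)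
      = p ^ (s + 1) • U := by
    intro k
    by_cases hk : k + 1 + 1 < p
    · obtain ⟨c, hc⟩ := choose_dvd hp s (k + 1) hk
      refine ⟨(c * p ^ k) • T ^ (k + 1), AA.nsmul_mem (hpow k) _, ?_⟩
      rw [hc, smul_pow, smul_smul, smul_smul]
      congr 1; ring
    · refine ⟨0, AA.zero_mem, ?_⟩
      have : (p • T) ^ (k + 1) = 0 := by
        rw [smul_pow]
        ext q
        obtain ⟨c, hc⟩ : ∃ c, k + 1 = n + c := ⟨k + 1 - n, by omega⟩
        rw [hc, pow_add, mul_smul]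
        exact htor _
      rw [this]; simp
  choose U hU hUe using hterm
  obtain ⟨m, hm⟩ : ∃ m, p ^ s = m + 1 :=
    ⟨p ^ s - 1, by have := pow_pos hp.pos s; omega⟩
  refine ⟨∑ k ∈ Finset.range m, U k, AA.sum_mem (fun k _ => hU k), ?_⟩
  rw [geom_choose]
  conv_lhs => rw [show Finset.range (p ^ s) = Finset.range (m + 1) by rw [hm]]
  rw [Finset.sum_range_succ', Finset.smul_sum, add_comm]
  congr 1
  · simp
  · exact Finset.sum_congr rfl (fun k _ => hUe k)

theorem core {Q : Type*} [AddCommGroup Q] (p n : ℕ) (hp : p.Prime) (hn : n ≤ p - 1)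
    (htor : ∀ q : Q, p ^ n • q = 0)
    (L : Q → Module.End ℤ Q) (L0 : L 0 = 0)
    (hL : ∀ a b, L (a + b + p • L a b) = L a + L b + p • (L a * L b))
    (AA VV : Submodule ℤ (Module.End ℤ Q)) (hVA : VV ≤ AA)
    (hAV : ∀ a ∈ AA, ∀ b ∈ AA, a * b ∈ VV)
    (X X2 : Set Q) (hXX : X2 ⊆ X)
    (hact : ∀ T ∈ AA, ∀ m ∈ Submodule.span ℤ X, T m ∈ Submodule.span ℤ X2)
    (hX : ∀ w ∈ X, L w ∈ AA) (hX2 : ∀ w ∈ X2, L w ∈ VV) (s : ℕ) :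
    (∀ w ∈ X, L (p ^ s • w) - p ^ s • L w ∈ PS p (s + 1) VV) ∧
    (∀ m ∈ Submodule.span ℤ X, ∀ m' ∈ Submodule.span ℤ X,
      L (p ^ s • m + p ^ s • m') - L (p ^ s • m) - L (p ^ s • m') ∈ PS p (s + 1) VV) ∧
    (∀ m ∈ Submodule.span ℤ X, L (p ^ s • m) ∈ PS p s AA) ∧
    (∀ m ∈ Submodule.span ℤ X2, L (p ^ s • m) ∈ PS p s VV) := by
  have hmul : ∀ a ∈ AA, ∀ b ∈ AA, a * b ∈ AA := fun a ha b hb => hVA (hAV a ha b hb)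
  have hMM : Submodule.span ℤ X2 ≤ Submodule.span ℤ X := Submodule.span_mono hXX
  by_cases hs : n ≤ s
  · have hz : ∀ q : Q, p ^ s • q = 0 := by
      intro q
      rw [show s = (s - n) + n by omega, pow_add, mul_smul, htor, smul_zero]
    have hz2 : ∀ E : Module.End ℤ Q, p ^ s • E = 0 := by
      intro E; ext q; exact hz (E q)
    simp [hz, hz2, L0]
  · obtain ⟨d, hd⟩ : ∃ d, n = s + d + 1 := ⟨n - s - 1, by omega⟩
    have hlt : n - (s + 1) < n - s := by omega
    obtain ⟨-, hb, hc, hdd⟩ := core p n hp hn htor L L0 hL AA VV hVA hAV X X2 hXX hact hX hX2 (s + 1)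
    -- perturbation lemma
    have K : ∀ m ∈ Submodule.span ℤ X, ∀ T ∈ AA, L (p ^ s • m) = p ^ s • T →
        ∀ m1 ∈ Submodule.span ℤ X2,
          L (p ^ s • m + p ^ (s + 1) • m1) - L (p ^ s • m) ∈ PS p (s + 1) VV := by
      intro m hm T hT hLT m1 hm1
      obtain ⟨R, hR, hRe⟩ := inv_exists p n htor AA hmul (p ^ s • T) (AA.nsmul_mem hT _)
      set e' := p ^ (s + 1) • (m1 + R m1) with he'
      have h1 : e' + p • L (p ^ s • m) e' = p ^ (s + 1) • m1 := by
        have h2 := LinearMap.congr_fun hRe (p ^ (s + 1) • m1)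
        rw [hLT]
        have h3 : (1 + R) (p ^ (s + 1) • m1) = e' := by
          simp [he', smul_add]
        rw [Module.End.mul_apply, h3] at h2
        simpa using h2
      have h4 := hL (p ^ s • m) e'
      rw [add_assoc, h1] at h4
      rw [h4]
      have hm1R : m1 + R m1 ∈ Submodule.span ℤ X2 :=
        Submodule.add_mem _ hm1 (hact R hR _ (hMM hm1))
      have h5 : L e' ∈ PS p (s + 1) VV := hdd _ hm1R
      obtain ⟨T', hT', hTe⟩ := mem_PS.1 h5
      have h6 : p • (L (p ^ s • m) * L e') ∈ PS p (s + 1) VV := by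
        refine mem_PS.2 ⟨p ^ (s + 1) • (T * T'), VV.nsmul_mem (hAV _ hT _ (hVA hT')) _, ?_⟩
        rw [hLT, hTe]
        simp only [smul_mul_assoc, mul_smul_comm, smul_smul]
        congr 1; ring
      have : L (p ^ s • m) + L e' + p • (L (p ^ s • m) * L e') - L (p ^ s • m)
        = L e' + p • (L (p ^ s • m) * L e') := by abel
      rw [this]
      exact Submodule.add_mem _ h5 h6
    have hP : ∀ w ∈ X, L (p ^ s • w) - p ^ s • L w ∈ PS p (s + 1) VV := by
      intro w hw
      obtain ⟨U, hU, hUe⟩ := geom_exists p n hp hn htor AA hmul (L w) (hX w hw) s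
      have hG : ∀ k : ℕ, L ((∑ k ∈ Finset.range k, (1 + p • L w) ^ k : Module.End ℤ Q) w)
          = (∑ k ∈ Finset.range k, (1 + p • L w) ^ k) * L w := by
        intro k
        induction k with
        | zero => simp [L0]
        | succ k ih =>
          have e1 : (∑ k ∈ Finset.range (k + 1), (1 + p • L w) ^ k : Module.End ℤ Q)
              = 1 + (∑ k ∈ Finset.range k, (1 + p • L w) ^ k)
                + p • (L w * ∑ k ∈ Finset.range k, (1 + p • L w) ^ k) := by
            rw [Finset.sum_range_succ', pow_zero]
            simp only [pow_succ']
            rw [← Finset.mul_sum, add_mul, one_mul, smul_mul_assoc]; abel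
          rw [e1]
          have h4 := hL w ((∑ k ∈ Finset.range k, (1 + p • L w) ^ k : Module.End ℤ Q) w)
          rw [ih] at h4
          simp only [LinearMap.add_apply, LinearMap.smul_apply, Module.End.mul_apply,
            Module.End.one_apply]
          rw [h4]
          simp only [add_mul, one_mul, smul_mul_assoc, mul_assoc]
      have hh := hG (p ^ s)
      rw [hUe] at hh
      have hwM : w ∈ Submodule.span ℤ X := Submodule.subset_span hw
      have hUw : U w ∈ Submodule.span ℤ X2 := hact U hU w hwM
      have e2 : (p ^ s • (1 : Module.End ℤ Q) + p ^ (s + 1) • U) w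
          = p ^ s • (w + p • U w) := by
        simp only [smul_add, smul_smul, pow_succ, LinearMap.add_apply, LinearMap.smul_apply,
          Module.End.one_apply]
      have e3 : (p ^ s • (1 : Module.End ℤ Q) + p ^ (s + 1) • U) * L w
          = p ^ s • (L w + p • (U * L w)) := by
        simp only [smul_add, smul_smul, pow_succ, add_mul, smul_mul_assoc, one_mul]
      rw [e2, e3] at hh
      have hk := K (w + p • U w)
        (Submodule.add_mem _ hwM (nsmul_mem (hMM hUw) _))
        (L w + p • (U * L w))
        (AA.add_mem (hX w hw) (AA.nsmul_mem (hmul _ hU _ (hX w hw)) _)) hh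
        (-(U w)) (Submodule.neg_mem _ hUw)
      have e4 : p ^ s • (w + p • U w) + p ^ (s + 1) • -(U w) = p ^ s • w := by
        simp [smul_add, smul_smul, pow_succ]
      rw [e4, hh] at hk
      have e5 : L (p ^ s • w) - p ^ s • L w
        = (L (p ^ s • w) - p ^ s • (L w + p • (U * L w))) + p ^ (s + 1) • (U * L w) := by
        rw [smul_add, smul_smul, ← pow_succ]; abel
      rw [e5]
      exact Submodule.add_mem _ hk (mem_PS.2 ⟨_, hAV _ hU _ (hX w hw), rfl⟩)
    have hR : ∀ m ∈ Submodule.span ℤ X, L (p ^ s • m) ∈ PS p s AA →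
        ∀ m' ∈ Submodule.span ℤ X, L (p ^ s • m') ∈ PS p s AA →
        L (p ^ s • m + p ^ s • m') - L (p ^ s • m) - L (p ^ s • m') ∈ PS p (s + 1) VV := by
      intro m hm hg m' hm' hg'
      obtain ⟨T, hT, hTe⟩ := mem_PS.1 hg
      obtain ⟨T', hT', hTe'⟩ := mem_PS.1 hg'
      have h4 := hL (p ^ s • m) (p ^ s • m')
      have hTm : p ^ s • T m' ∈ Submodule.span ℤ X2 := nsmul_mem (hact T hT m' hm') _
      have e1 : p ^ s • m + p ^ s • m' + p • (L (p ^ s • m)) (p ^ s • m')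
          = p ^ s • (m + m' + p • (p ^ s • T m')) := by
        rw [hTe]
        simp only [LinearMap.smul_apply, map_nsmul, smul_add, smul_smul]
        congr 2; ring
      have e2 : L (p ^ s • m) + L (p ^ s • m') + p • (L (p ^ s • m) * L (p ^ s • m'))
          = p ^ s • (T + T' + p ^ (s + 1) • (T * T')) := by
        rw [hTe, hTe']
        simp only [smul_mul_assoc, mul_smul_comm, smul_add, smul_smul]
        congr 2; ring
      have h4' := h4
      rw [e1, e2] at h4
      have hk := K _ (Submodule.add_mem _ (Submodule.add_mem _ hm hm')
        (nsmul_mem (hMM hTm) p)) _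
        (AA.add_mem (AA.add_mem hT hT') (AA.nsmul_mem (hmul _ hT _ hT') _)) h4
        (-(p ^ s • T m')) (Submodule.neg_mem _ hTm)
      have e3 : p ^ s • (m + m' + p • (p ^ s • T m')) + p ^ (s + 1) • -(p ^ s • T m')
          = p ^ s • m + p ^ s • m' := by
        simp only [smul_add, smul_neg, smul_smul, pow_succ, mul_assoc]; abel
      rw [e3, h4, ← e2] at hk
      have e5 : L (p ^ s • m + p ^ s • m') - L (p ^ s • m) - L (p ^ s • m')
          = (L (p ^ s • m + p ^ s • m')
            - (L (p ^ s • m) + L (p ^ s • m') + p • (L (p ^ s • m) * L (p ^ s • m'))))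
            + p • (L (p ^ s • m) * L (p ^ s • m')) := by abel
      rw [e5]
      refine Submodule.add_mem _ hk (mem_PS.2 ⟨p ^ s • (T * T'), VV.nsmul_mem (hAV _ hT _ hT') _, ?_⟩)
      rw [hTe, hTe']
      simp only [smul_mul_assoc, mul_smul_comm, smul_smul]
      congr 1; ring
    have hgen : ∀ (C : Submodule ℤ (Module.End ℤ Q)), VV ≤ C → C ≤ AA → ∀ Y : Set Q, Y ⊆ X →
        (∀ y ∈ Y, L y ∈ C) → ∀ m ∈ Submodule.span ℤ Y,
          m ∈ Submodule.span ℤ X ∧ L (p ^ s • m) ∈ PS p s C := by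
      intro C hVC hCA Y hYX hY
      refine span_ind_tors (p ^ n) (pow_pos hp.pos n) htor Y _ ?_ ?_ ?_
      · intro y hy
        refine ⟨Submodule.subset_span (hYX hy), ?_⟩
        rw [← sub_add_cancel (L (p ^ s • y)) (p ^ s • L y)]
        exact Submodule.add_mem _ (PS_anti (Nat.le_succ s) hVC (hP y (hYX hy)))
          (mem_PS.2 ⟨_, hY y hy, rfl⟩)
      · exact ⟨Submodule.zero_mem _, by simp [L0]⟩
      · rintro a b ⟨ha, hga⟩ ⟨hb, hgb⟩
        refine ⟨Submodule.add_mem _ ha hb, ?_⟩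
        have := hR a ha (PS_anti le_rfl hCA hga) b hb (PS_anti le_rfl hCA hgb)
        rw [smul_add]
        have e : L (p ^ s • a + p ^ s • b) = (L (p ^ s • a + p ^ s • b) - L (p ^ s • a)
          - L (p ^ s • b)) + L (p ^ s • a) + L (p ^ s • b) := by abel
        rw [e]
        exact Submodule.add_mem _ (Submodule.add_mem _ (PS_anti (Nat.le_succ s) hVC this) hga) hgb
    have hC := fun m hm => (hgen AA hVA le_rfl X subset_rfl hX m hm).2
    refine ⟨hP, fun m hm m' hm' => hR m hm (hC m hm) m' hm' (hC m' hm'), hC, ?_⟩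
    exact fun m hm => (hgen VV le_rfl hVA X2 hXX hX2 m hm).2
termination_by n - s

theorem nilp (p : ℕ) [Fact p.Prime] {G : Type*} [Group G] (hG : IsPGroup p G) (n : ℕ) :
    ∀ (M : Type u) [AddCommGroup M] [Finite M] (ρ : G →* Module.End ℤ M), Nat.card M ∣ p ^ n →
      ∀ l : List G, l.length = n → (l.map (fun g => ρ g - 1)).prod = 0 := by
  have hp : p.Prime := Fact.out
  induction n with
  | zero =>
    intro M _ _ ρ hc l hl
    have : Subsingleton M := by
      rw [pow_zero, Nat.dvd_one] at hc
      exact (Nat.card_eq_one_iff_unique.1 hc).1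
    ext m
    exact Subsingleton.elim _ _
  | succ n ih =>
    intro M _ _ ρ hc l hl
    rcases subsingleton_or_nontrivial M with hM | hM
    · ext m
      exact Subsingleton.elim _ _
    let F : Submodule ℤ M :=
      { carrier := {m | ∀ g, ρ g m = m}
        zero_mem' := fun g => map_zero _
        add_mem' := fun {a b} ha hb g => by rw [map_add, ha g, hb g]
        smul_mem' := fun z a ha g => by rw [map_smul, ha g] }
    have hF : ∀ m, m ∈ F ↔ ∀ g, ρ g m = m := fun m => Iff.rfl
    let act : MulAction G M :=
      { smul := fun g m => ρ g m
        one_smul := fun m => by change ρ 1 m = m; rw [map_one]; rfl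
        mul_smul := fun g h m => by change ρ (g * h) m = ρ g (ρ h m); rw [map_mul]; rfl }
    have hpM : p ∣ Nat.card M := by
      obtain ⟨k, hk, hk2⟩ := (Nat.dvd_prime_pow hp).1 hc
      rcases k with _ | k
      · have h1 : 1 < Nat.card M := Finite.one_lt_card
        rw [hk2] at h1; simp at h1
      · rw [hk2]; exact dvd_pow_self p (by omega)
    obtain ⟨b, hb, hb0⟩ := hG.exists_fixed_point_of_prime_dvd_card_of_fixed_point M hpM
      (a := (0 : M)) (fun g => map_zero (ρ g))
    have hbF : b ∈ F := fun g => hb g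
    have hpF : p ∣ Nat.card F := by
      have hd : Nat.card F ∣ p ^ (n + 1) := (AddSubgroup.card_addSubgroup_dvd_card F.toAddSubgroup).trans hc
      obtain ⟨k, hk, hk2⟩ := (Nat.dvd_prime_pow hp).1 hd
      rcases k with _ | k
      · have : Nontrivial F := ⟨⟨⟨b, hbF⟩, 0, fun h => hb0 (congrArg Subtype.val h).symm⟩⟩
        have h1 : 1 < Nat.card F := Finite.one_lt_card
        rw [hk2] at h1; simp at h1
      · rw [hk2]; exact dvd_pow_self p (by omega)
    have hQ : Nat.card (M ⧸ F) ∣ p ^ n := by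
      have h1 := AddSubgroup.card_eq_card_quotient_mul_card_addSubgroup F.toAddSubgroup
      obtain ⟨c, hc2⟩ := hpF
      change Nat.card M = Nat.card (M ⧸ F) * Nat.card F at h1
      rw [h1, hc2, pow_succ] at hc
      have : Nat.card (M ⧸ F) * p ∣ p ^ n * p :=
        (Dvd.intro c (by ring)).trans hc
      exact Nat.dvd_of_mul_dvd_mul_right hp.pos this
    have hinv : ∀ g, F ≤ F.comap (ρ g) := by
      intro g m hm
      rw [Submodule.mem_comap, (hF m).1 hm g]; exact hm
    let ρ' : G →* Module.End ℤ (M ⧸ F) :=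
      { toFun := fun g => Submodule.mapQ F F (ρ g) (hinv g)
        map_one' := by
          ext m
          change (Submodule.Quotient.mk (ρ 1 m) : M ⧸ F) = Submodule.Quotient.mk m
          rw [map_one]; rfl
        map_mul' := fun g h => by
          ext m
          change (Submodule.Quotient.mk (ρ (g * h) m) : M ⧸ F) = Submodule.Quotient.mk (ρ g (ρ h m))
          rw [map_mul]; rfl }
    have hmk : ∀ (l : List G) (m : M),
        (Submodule.Quotient.mk ((l.map (fun g => ρ g - 1)).prod m) : M ⧸ F)
          = (l.map (fun g => ρ' g - 1)).prod (Submodule.Quotient.mk m) := by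
      intro l
      induction l with
      | nil => intro m; rfl
      | cons g l ihl =>
        intro m
        rw [List.map_cons, List.map_cons, List.prod_cons, List.prod_cons, Module.End.mul_apply,
          Module.End.mul_apply, ← ihl]
        rfl
    match l, hl with
    | g :: l, hl =>
      have hl' : l.length = n := by simpa using hl
      have : Finite (M ⧸ F) := Finite.of_surjective _ (Submodule.mkQ_surjective F)
      have h0 := ih (M ⧸ F) ρ' hQ l hl'
      ext m
      have hm := hmk l m
      rw [h0] at hm
      have hm2 : (l.map (fun g => ρ g - 1)).prod m ∈ F := by
        rw [← Submodule.Quotient.mk_eq_zero]; exact hm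
      rw [List.map_cons, List.prod_cons, Module.End.mul_apply]
      have := (hF _).1 hm2 g
      change ρ g _ - _ = 0
      rw [this]; exact sub_self _

/-- the polynomial `((X+1)^p - 1)/(pX)`, without the top term. -/
theorem poly_exists {p : ℕ} (hp : p.Prime) {R : Type*} [Ring R] (m : ℕ) (hm : m ≤ p - 1) :
    ∃ c : ℕ → ℕ, ∀ t : R, t ^ m = 0 →
      ∑ k ∈ Finset.range p, (1 + t) ^ k
        = p • (1 + ∑ k ∈ Finset.range (p - 2), c k • t ^ (k + 1)) := by
  have hd : ∀ k, ∃ c, k + 2 < p → p.choose (k + 2) = p * c := by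
    intro k
    by_cases h : k + 2 < p
    · obtain ⟨c, hc⟩ := hp.dvd_choose_self (k := k + 2) (by omega) h
      exact ⟨c, fun _ => hc⟩
    · exact ⟨0, fun h' => absurd h' h⟩
  choose c hc using hd
  refine ⟨c, fun t ht => ?_⟩
  have h2 := hp.two_le
  rw [geom_choose]
  obtain ⟨q, rfl⟩ : ∃ q, p = q + 2 := ⟨p - 2, by omega⟩
  rw [Finset.sum_range_succ, Finset.sum_range_succ']
  have ht2 : t ^ (q + 1) = 0 := by
    rw [show q + 1 = (q + 1 - m) + m by omega, pow_add, ht, mul_zero]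
  rw [ht2, smul_zero, add_zero, smul_add, add_comm, Finset.smul_sum]
  congr 1
  · simp
  · refine Finset.sum_congr (by simp) (fun k hk => ?_)
    rw [hc k (by simp at hk; omega), smul_smul]

/-- `p•t = p•s` from equality of `p`-th powers of unipotents. -/
theorem smul_eq_of_pow {p n : ℕ} (hp : p.Prime) (hn : n ≤ p - 1) {R : Type*} [Ring R] (t s : R)
    (ht : t ^ n = 0) (hs : s ^ n = 0)
    (hz : ∀ i j, n ≤ i + j → t ^ i * s ^ j = 0)
    (h : (1 + t) ^ p = (1 + s) ^ p) : p • t = p • s := by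
  obtain ⟨c, hc⟩ := poly_exists (R := R) hp n hn
  have hpow : ∀ r : R, r ^ n = 0 → (1 + r) ^ p - 1
      = p • r + ∑ k ∈ Finset.range (p - 2), c k • (p • r ^ (k + 2)) := by
    intro r hr
    have h1 := geom_sum_mul (1 + r) p
    rw [hc r hr, add_sub_cancel_left] at h1
    rw [← h1, smul_mul_assoc, add_mul, one_mul, smul_add, Finset.sum_mul, Finset.smul_sum]
    congr 1
    refine Finset.sum_congr rfl (fun k _ => ?_)
    rw [smul_mul_assoc, ← pow_succ, smul_comm]
  have key : p • (t - s)
      = - ∑ k ∈ Finset.range (p - 2), c k • (p • (t ^ (k + 2) - s ^ (k + 2))) := by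
    have e1 := hpow t ht
    have e2 := hpow s hs
    rw [h, e2] at e1
    simp only [smul_sub, Finset.sum_sub_distrib]
    rw [neg_sub, sub_eq_sub_iff_add_eq_add, ← e1, add_comm]
  have claim : ∀ d i j, n ≤ i + j + d → t ^ i * (p • (t - s)) * s ^ j = 0 := by
    intro d
    induction d with
    | zero =>
      intro i j hij
      have a1 := hz (i + 1) j (by omega)
      have a2 := hz i (j + 1) (by omega)
      rw [mul_smul_comm, smul_mul_assoc, mul_sub, sub_mul, ← pow_succ, a1, mul_assoc, ← pow_succ',
        a2]; simp
    | succ d ih =>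
      have hk : ∀ k i j, n ≤ i + j + d → t ^ i * (p • (t ^ k - s ^ k)) * s ^ j = 0 := by
        intro k
        induction k with
        | zero => intro i j _; simp
        | succ k ihk =>
          intro i j hij
          have e : p • (t ^ (k + 1) - s ^ (k + 1))
              = t * (p • (t ^ k - s ^ k)) + (p • (t - s)) * s ^ k := by
            rw [mul_smul_comm, smul_mul_assoc, ← smul_add, pow_succ', pow_succ' s]
            congr 1; noncomm_ring
          rw [e, mul_add, add_mul, ← mul_assoc, ← pow_succ, ihk (i + 1) j (by omega), zero_add,
            ← mul_assoc, mul_assoc, ← pow_add, ih i (k + j) (by omega)]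
      intro i j hij
      rw [key, mul_neg, neg_mul, Finset.mul_sum, Finset.sum_mul, neg_eq_zero]
      refine Finset.sum_eq_zero (fun k _ => ?_)
      have e : p • (t ^ (k + 2) - s ^ (k + 2))
          = t * (p • (t ^ (k + 1) - s ^ (k + 1))) + (p • (t - s)) * s ^ (k + 1) := by
        rw [mul_smul_comm, smul_mul_assoc, ← smul_add, pow_succ', pow_succ' s (k + 1)]
        congr 1; noncomm_ring
      rw [e, mul_smul_comm, smul_mul_assoc, mul_add, add_mul, ← mul_assoc, ← pow_succ,
        hk (k + 1) (i + 1) j (by omega), zero_add,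
        ← mul_assoc, mul_assoc, ← pow_add, ih i (k + 1 + j) (by omega), smul_zero]
  have := claim n 0 0 (by omega)
  simp only [pow_zero, one_mul, mul_one, smul_sub] at this
  exact sub_eq_zero.1 this

namespace LeftBrace

variable {A : Type u} [AddCommGroup A] (B : LeftBrace A)

theorem circ_zero (a : A) : B.circ a 0 = a := by
  have h := B.circ_add a 0 0
  rw [add_zero] at h
  exact (add_left_cancel h).symm

theorem one_eq : B.one = 0 := by
  rw [← B.circ_zero B.one, B.one_circ]

theorem star_add (a b c : A) : B.star a (b + c) = B.star a b + B.star a c := by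
  unfold star
  have h := B.circ_add a b c
  rw [eq_sub_of_add_eq h]; abel

theorem zero_star (b : A) : B.star 0 b = 0 := by
  unfold star
  rw [← B.one_eq, B.one_circ, B.one_eq]; simp

theorem star_circ (u v b : A) :
    B.star (u + v + B.star u v) b = B.star u b + B.star v b + B.star u (B.star v b) := by
  have h1 : u + v + B.star u v = B.circ u v := by unfold star; abel
  have h2 : B.circ v b = B.star v b + v + b := by unfold star; abel
  have h3 : B.star u (B.circ v b) = B.star u (B.star v b) + B.star u v + B.star u b := by
    rw [h2, star_add, star_add]
  have h4 : B.star (B.circ u v) b = B.circ u (B.circ v b) - B.circ u v - b := by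
    unfold star; rw [B.circ_assoc]
  have h5 : B.circ u (B.circ v b) = B.star u (B.circ v b) + u + B.circ v b := by
    unfold star; abel
  rw [h1, h4, h5, h3, h2, ← h1]; abel

/-- The group structure. -/
abbrev grp : Group A :=
  letI : Mul A := ⟨B.circ⟩
  letI : One A := ⟨B.one⟩
  letI : Inv A := ⟨B.inv⟩
  Group.ofLeftAxioms B.circ_assoc B.one_circ B.inv_circ

/-- `λ_a - 1`. -/
def starEnd (a : A) : Module.End ℤ A := (AddMonoidHom.mk' (B.star a) (B.star_add a)).toIntLinearMap

/-- every `(p a) * b` is divisible by `p`. -/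
theorem star_dvd {p n : ℕ} (hp : p.Prime) (hn : n < p - 1) (hcard : Nat.card A = p ^ n)
    (a b : A) : ∃ c, p • c = B.star (p • a) b := by
  have : Fact p.Prime := ⟨hp⟩
  have : Finite A := Nat.finite_of_card_ne_zero (by rw [hcard]; exact pow_ne_zero _ hp.ne_zero)
  let G : Group A := B.grp
  have hmul : ∀ a b : A, a * b = B.circ a b := fun _ _ => rfl
  have hone : (1 : A) = 0 := B.one_eq
  have hG : IsPGroup p A := IsPGroup.of_card hcard
  let ρ : A →* Module.End ℤ A :=
    { toFun := fun a => 1 + B.starEnd a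
      map_one' := by
        ext b
        change b + B.star 1 b = b
        rw [hone, B.zero_star, add_zero]
      map_mul' := fun u v => by
        ext b
        change b + B.star (u * v) b = (b + B.star v b) + B.star u (b + B.star v b)
        have h1 : u + v + B.star u v = u * v := by rw [hmul]; unfold star; abel
        rw [← h1, B.star_circ, B.star_add]; abel }
  have hρ : ∀ a, ρ a = 1 + B.starEnd a := fun _ => rfl
  have hnil := nilp p hG n A ρ (by rw [hcard])
  have hz : ∀ (a b : A) (i j : ℕ), n ≤ i + j → B.starEnd a ^ i * B.starEnd b ^ j = 0 := by
    have hz0 : ∀ (a b : A) (i j : ℕ), i + j = n → B.starEnd a ^ i * B.starEnd b ^ j = 0 := by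
      intro a b i j h
      have := hnil (List.replicate i a ++ List.replicate j b) (by simp [h])
      simpa [hρ] using this
    intro a b i j h
    by_cases hi : i ≤ n
    · obtain ⟨d, rfl⟩ : ∃ d, j = (n - i) + d := ⟨j - (n - i), by omega⟩
      rw [pow_add, ← mul_assoc, hz0 a b i (n - i) (by omega), zero_mul]
    · obtain ⟨d, rfl⟩ : ∃ d, i = d + n := ⟨i - n, by omega⟩
      have := hz0 a b n 0 (by omega)
      rw [pow_zero, mul_one] at this
      rw [pow_add, this, mul_zero, zero_mul]
  have hzn : ∀ a, B.starEnd a ^ n = 0 := fun a => by simpa using hz a a n 0 (by omega)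
  obtain ⟨c, hc⟩ := poly_exists (R := Module.End ℤ A) hp n hn.le
  have hpw : ∀ (a : A) (k : ℕ), a ^ k = (∑ k ∈ Finset.range k, ρ a ^ k) a := by
    intro a k
    induction k with
    | zero => simpa using hone
    | succ k ih =>
      rw [Finset.sum_range_succ']
      simp only [pow_succ']
      rw [← Finset.mul_sum, pow_zero, ih, hmul]
      change _ = ρ a ((∑ k ∈ Finset.range k, ρ a ^ k) a) + a
      generalize (∑ k ∈ Finset.range k, ρ a ^ k) a = z
      change _ = z + B.star a z + a
      unfold star; abel
  let H : A → Module.End ℤ A := fun a =>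
    1 + ∑ k ∈ Finset.range (p - 2), c k • B.starEnd a ^ (k + 1)
  have hpp : ∀ a : A, a ^ p = p • H a a := by
    intro a
    rw [hpw, hρ, hc _ (hzn a)]; rfl
  have hinj : ∀ a b : A, a ^ p = b ^ p → p • a = p • b := by
    intro a b h
    have h1 : (1 + B.starEnd a) ^ p = (1 + B.starEnd b) ^ p := by
      rw [← hρ, ← hρ, ← map_pow, ← map_pow, h]
    have h2 := smul_eq_of_pow hp hn.le _ _ (hzn a) (hzn b) (hz a b) h1
    have h3 : ∀ k, p • B.starEnd a ^ k = p • B.starEnd b ^ k := by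
      intro k
      induction k with
      | zero => simp
      | succ k ih =>
        rw [pow_succ, ← smul_mul_assoc, ih, smul_mul_assoc, ← mul_smul_comm, h2, mul_smul_comm,
          pow_succ]
    have h4 : p • H a = p • H b := by
      simp only [H, smul_add, Finset.smul_sum]
      congr 1
      refine Finset.sum_congr rfl (fun k _ => ?_)
      rw [smul_comm, h3, smul_comm]
    rw [hpp, hpp] at h
    have h5 : p • H b b = p • H a b := by
      have := DFunLike.congr_fun h4 b
      exact this.symm
    rw [h5] at h
    have hu : IsUnit (H a) := by
      apply IsNilpotent.isUnit_one_add
      have : ∑ k ∈ Finset.range (p - 2), c k • B.starEnd a ^ (k + 1)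
          = B.starEnd a * ∑ k ∈ Finset.range (p - 2), c k • B.starEnd a ^ k := by
        rw [Finset.mul_sum]
        refine Finset.sum_congr rfl (fun k _ => ?_)
        rw [mul_smul_comm, pow_succ']
      rw [this]
      refine Commute.isNilpotent_mul_right ?_ ⟨n, hzn a⟩
      refine Commute.sum_right _ _ _ (fun k _ => ?_)
      exact ((Commute.refl _).pow_right k).smul_right _
    obtain ⟨w, hw⟩ := hu
    have h6 : H a (p • a) = H a (p • b) := by rw [map_nsmul, map_nsmul, h]
    have h7 := congrArg (fun z => (↑w⁻¹ : Module.End ℤ A) z) h6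
    have h8 : ∀ z, (↑w⁻¹ : Module.End ℤ A) (H a z) = z := by
      intro z
      rw [← Module.End.mul_apply, ← hw, Units.inv_mul]; rfl
    simpa only [h8] using h7
  -- counting
  let P : Set A := Set.range (fun a : A => p • a)
  let Wp : Set A := Set.range (fun a : A => a ^ p)
  have hsub : Wp ⊆ P := by
    rintro _ ⟨a, rfl⟩
    exact ⟨H a a, (hpp a).symm⟩
  have hcardle : P.ncard ≤ Wp.ncard := by
    choose! r hr using (fun (x : A) (hx : x ∈ Wp) => hx)
    have himg : P ⊆ (fun x => p • r x) '' Wp := by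
      rintro _ ⟨a, rfl⟩
      refine ⟨a ^ p, ⟨a, rfl⟩, ?_⟩
      exact hinj _ _ (hr (a ^ p) ⟨a, rfl⟩)
    exact (Set.ncard_le_ncard himg (Set.toFinite _)).trans (Set.ncard_image_le (Set.toFinite _))
  have hEq : Wp = P := Set.eq_of_subset_of_ncard_le hsub hcardle (Set.toFinite _)
  have ha : p • a ∈ Wp := by rw [hEq]; exact ⟨a, rfl⟩
  obtain ⟨g, hg⟩ := ha
  have h1 := geom_sum_mul (1 + B.starEnd g) p
  rw [hc _ (hzn g), ← hρ, ← map_pow] at h1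
  have h2 : ρ (g ^ p) - 1 = B.starEnd (p • a) := by
    rw [hρ, add_sub_cancel_left]; congr 1
  rw [h2, smul_mul_assoc] at h1
  exact ⟨_, DFunLike.congr_fun h1 b⟩

end LeftBrace

theorem wLen_pos {α : Type*} (w : FreeMagma α) : 0 < wLen w := by
  induction w with
  | ih1 a => exact Nat.one_pos
  | ih2 x y hx hy => exact Nat.add_pos_left hx _

theorem wLast_mem {α : Type*} (w : FreeMagma α) : wLast w ∈ wLeaves w := by
  induction w with
  | ih1 a => exact List.mem_singleton.2 rfl
  | ih2 x y hx hy => exact List.mem_append_right _ hy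

theorem wLast_getLast {α : Type*} (w : FreeMagma α) :
    (wLeaves w).getLast? = some (wLast w) := by
  induction w with
  | ih1 a => rfl
  | ih2 x y hx hy =>
    change (wLeaves x ++ wLeaves y).getLast? = some (wLast y)
    rw [List.getLast?_append, hy]; rfl

theorem wCount_eq {α : Type*} [DecidableEq α] (a : α) (w : FreeMagma α) :
    wCount a w = (wLeaves w).count a := by
  induction w with
  | ih1 b => 
    change (if b = a then 1 else 0) = [b].count a
    rw [List.count_singleton]; simp
  | ih2 x y hx hy =>
    change wCount a x + wCount a y = (wLeaves x ++ wLeaves y).count a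
    rw [List.count_append, hx, hy]

/-- endomorphisms mapping `N` into `N'`. -/
def mapsSub {Q : Type*} [AddCommGroup Q] (N N' : Submodule ℤ Q) :
    Submodule ℤ (Module.End ℤ Q) where
  carrier := {T | ∀ z ∈ N, T z ∈ N'}
  zero_mem' := fun z _ => N'.zero_mem
  add_mem' := fun ha hb z hz => N'.add_mem (ha z hz) (hb z hz)
  smul_mem' := fun c _ ha z hz => N'.smul_mem c (ha z hz)

theorem mapsSub_of_gen {Q : Type*} [AddCommGroup Q] (Y : Set Q) (N' : Submodule ℤ Q)
    (T : Module.End ℤ Q) (h : ∀ y ∈ Y, T y ∈ N') : T ∈ mapsSub (Submodule.span ℤ Y) N' := by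
  intro z hz
  have : Submodule.span ℤ Y ≤ N'.comap T := Submodule.span_le.2 h
  exact this hz

/-- words ending in the last letter of `W`, which occurs once, of length at least `k`,
with letters in `l`. -/
def TSet {α : Type*} [DecidableEq α] (a : α) (l : List α) (k : ℕ) : Set (FreeMagma α) :=
  {v | k ≤ wLen v ∧ wLast v = a ∧ wCount a v = 1 ∧ ∀ c ∈ wLeaves v, c ∈ l}

theorem words_main {α : Type*} [DecidableEq α] {A Q : Type*} [AddCommGroup A] [AddCommGroup Q]
    (p n : ℕ) (hp : p.Prime) (hn : n ≤ p - 1) (π : A →+ Q) (hπ : Function.Surjective π)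
    (star : A → A → A) (odot : Q → Q → Q)
    (H0 : ∀ q : Q, p ^ n • q = 0)
    (H1 : ∀ a b c, star a (b + c) = star a b + star a c)
    (H2 : ∀ a b, ∃ c, p • c = star (p • a) b)
    (H3 : ∀ a b c, p • c = star (p • a) b → odot (π a) (π b) = π c)
    (H4 : ∀ a b : A, p • a = p • b → π a = π b)
    (H5 : ∀ u v b, star (u + v + star u v) b = star u b + star v b + star u (star v b))
    (H6 : ∀ b, star 0 b = 0)
    (x : α → A) (i : α → ℕ) (W : FreeMagma α) :
    (wLeaves W).Nodup → (∀ k ∈ wLeaves W, k ≠ wLast W → 0 < i k) →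
    (∃ r ∈ Submodule.span ℤ (wEval odot (fun k => π (x k)) '' TSet (wLast W) (wLeaves W) 3),
      π (wEval star (fun k => p ^ i k • x k) W)
        = p ^ ((wLeaves W).map i).sum • wEval odot (fun k => π (x k)) W
          + p ^ (((wLeaves W).map i).sum + 1) • r) ∧
    (0 < i (wLast W) ∨ 1 < wLen W →
      ∃ y, p • y = wEval star (fun k => p ^ i k • x k) W ∧
      ∃ r ∈ Submodule.span ℤ (wEval odot (fun k => π (x k)) '' TSet (wLast W) (wLeaves W) 3),
      π y = p ^ (((wLeaves W).map i).sum - 1) • wEval odot (fun k => π (x k)) W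
          + p ^ ((wLeaves W).map i).sum • r) := by
  have hs : ∀ (a b : A) (k : ℕ), star a (k • b) = k • star a b := fun a b k =>
    map_nsmul (AddMonoidHom.mk' (star a) (H1 a)) k b
  have hadd : ∀ a b c, odot a (b + c) = odot a b + odot a c := by
    intro a b c
    obtain ⟨a, rfl⟩ := hπ a
    obtain ⟨b, rfl⟩ := hπ b
    obtain ⟨c, rfl⟩ := hπ c
    obtain ⟨d, hd⟩ := H2 a b
    obtain ⟨e, he⟩ := H2 a c
    rw [H3 a b d hd, H3 a c e he, ← map_add, ← map_add]
    exact H3 _ _ _ (by rw [H1, smul_add, hd, he])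
  let L : Q → Module.End ℤ Q := fun a => (AddMonoidHom.mk' (odot a) (hadd a)).toIntLinearMap
  have hLa : ∀ a b, L a b = odot a b := fun _ _ => rfl
  have L0 : L 0 = 0 := by
    ext b
    obtain ⟨b, rfl⟩ := hπ b
    rw [hLa, ← map_zero π, H3 0 b 0 (by rw [smul_zero, H6])]
    simp
  have hL : ∀ a b, L (a + b + p • L a b) = L a + L b + p • (L a * L b) := by
    intro a b
    ext c
    obtain ⟨a, rfl⟩ := hπ a
    obtain ⟨b, rfl⟩ := hπ b
    obtain ⟨c, rfl⟩ := hπ c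
    obtain ⟨d, hd⟩ := H2 a b
    obtain ⟨e1, he1⟩ := H2 a c
    obtain ⟨e2, he2⟩ := H2 b c
    obtain ⟨e3, he3⟩ := H2 a e2
    change odot (π a + π b + p • odot (π a) (π b)) (π c)
      = odot (π a) (π c) + odot (π b) (π c) + p • odot (π a) (odot (π b) (π c))
    rw [H3 a b d hd, H3 a c e1 he1, H3 b c e2 he2, H3 a e2 e3 he3]
    simp only [← map_nsmul, ← map_add]
    apply H3
    have e : p • (a + b + p • d) = p • a + p • b + star (p • a) (p • b) := by
      rw [hs, ← hd]; simp only [smul_add]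
    rw [e, H5, ← he1, ← he2, hs, ← he3]
    simp only [smul_add]
  induction W with
  | ih1 a =>
    intro _ _
    refine ⟨⟨0, Submodule.zero_mem _, ?_⟩, ?_⟩
    · simp [wEval, wLeaves]
    · intro h
      have h0 : 0 < i a := by
        rcases h with h | h
        · exact h
        · exact absurd h (lt_irrefl 1)
      refine ⟨p ^ (i a - 1) • x a, ?_, 0, Submodule.zero_mem _, ?_⟩
      · change _ = p ^ i a • x a
        rw [smul_smul, ← pow_succ']; congr 2; omega
      · simp [wEval, wLeaves]
  | ih2 W1 W2 ih1 ih2 =>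
    intro hnd hi
    have hlv : wLeaves (W1 * W2) = wLeaves W1 ++ wLeaves W2 := rfl
    have hla : wLast (W1 * W2) = wLast W2 := rfl
    rw [hla] at hi ⊢
    rw [hlv] at hnd hi ⊢
    obtain ⟨hnd1, hnd2, hdis⟩ := List.nodup_append'.1 hnd
    have hnot : wLast W2 ∉ wLeaves W1 := fun h => hdis h (wLast_mem W2)
    have hpos1 : ∀ k ∈ wLeaves W1, 0 < i k := fun k hk =>
      hi k (List.mem_append_left _ hk) (fun h => hnot (h ▸ hk))
    obtain ⟨y1, hy1, r1, hr1, hπ1⟩ := (ih1 hnd1 (fun k hk _ => hpos1 k hk)).2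
      (Or.inl (hpos1 _ (wLast_mem W1)))
    obtain ⟨r2, hr2, hπ2⟩ := (ih2 hnd2 (fun k hk h => hi k (List.mem_append_right _ hk) h)).1
    set ev := wEval odot (fun k => π (x k)) with hev
    have hevm : ∀ u v, ev (u * v) = L (ev u) (ev v) := fun _ _ => rfl
    obtain ⟨t, ht⟩ : ∃ t, ((wLeaves W1).map i).sum = t + 1 := by
      have h1 : i (wLast W1) ≤ ((wLeaves W1).map i).sum :=
        List.le_sum_of_mem (List.mem_map_of_mem (wLast_mem W1))
      have := hpos1 _ (wLast_mem W1)
      exact ⟨((wLeaves W1).map i).sum - 1, by omega⟩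
    set s2 := ((wLeaves W2).map i).sum with hs2
    rw [ht, Nat.add_sub_cancel] at hπ1
    set l := wLeaves W1 ++ wLeaves W2 with hl
    set z := wLast W2 with hz
    let S1 : ℕ → Set (FreeMagma α) := fun k => {w | k ≤ wLen w ∧ ∀ c ∈ wLeaves w, c ∈ wLeaves W1}
    have hmulS : ∀ w ∈ S1 1, ∀ w' ∈ S1 1, w * w' ∈ S1 2 := by
      rintro w ⟨h1, h2⟩ w' ⟨h3, h4⟩
      refine ⟨?_, ?_⟩
      · change 2 ≤ wLen w + wLen w'; omega
      · intro c hc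
        rcases List.mem_append.1 (show c ∈ wLeaves w ++ wLeaves w' from hc) with h | h
        · exact h2 c h
        · exact h4 c h
    have hmulT : ∀ a b, ∀ w ∈ S1 a, ∀ v ∈ TSet z l b, w * v ∈ TSet z l (a + b) := by
      rintro a b w ⟨h1, h2⟩ v ⟨h3, h4, h5, h6⟩
      refine ⟨?_, h4, ?_, ?_⟩
      · change a + b ≤ wLen w + wLen v; omega
      · change wCount z w + wCount z v = 1
        have : wCount z w = 0 := by
          rw [wCount_eq, List.count_eq_zero]
          exact fun h => hnot (h2 _ h)
        omega
      · intro c hc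
        rcases List.mem_append.1 (show c ∈ wLeaves w ++ wLeaves v from hc) with h | h
        · exact List.mem_append_left _ (h2 c h)
        · exact h6 c h
    have hTmono : ∀ a b, a ≤ b → TSet z l b ⊆ TSet z l a := by
      rintro a b hab v ⟨h1, h2⟩
      exact ⟨hab.trans h1, h2⟩
    have hS21 : S1 2 ⊆ S1 1 := fun w h => ⟨le_trans (by norm_num) h.1, h.2⟩
    let T : ℕ → Submodule ℤ Q := fun k => Submodule.span ℤ (ev '' TSet z l k)
    have hT : ∀ a b, a ≤ b → T b ≤ T a := fun a b hab =>
      Submodule.span_mono (Set.image_mono (hTmono a b hab))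
    let M := Submodule.span ℤ (ev '' S1 1)
    let M2 := Submodule.span ℤ (ev '' S1 2)
    have hM21 : M2 ≤ M := Submodule.span_mono (Set.image_mono hS21)
    let AA := mapsSub M M2 ⊓ (mapsSub (T 1) (T 2) ⊓ mapsSub (T 2) (T 3))
    let VV := AA ⊓ mapsSub (T 1) (T 3)
    have hLT : ∀ a b, ∀ w ∈ S1 a, L (ev w) ∈ mapsSub (T b) (T (a + b)) := by
      intro a b w hw
      refine mapsSub_of_gen _ _ _ ?_
      rintro _ ⟨v, hv, rfl⟩
      rw [← hevm]
      exact Submodule.subset_span ⟨_, hmulT a b w hw v hv, rfl⟩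
    have hLA : ∀ w ∈ S1 1, L (ev w) ∈ AA := by
      intro w hw
      refine ⟨mapsSub_of_gen _ _ _ ?_, hLT 1 1 w hw, hLT 1 2 w hw⟩
      rintro _ ⟨v, hv, rfl⟩
      rw [← hevm]
      exact Submodule.subset_span ⟨_, hmulS w hw v hv, rfl⟩
    have hcore := core p n hp hn H0 L L0 hL AA VV inf_le_left
      (by
        rintro a ⟨a1, a2, a3⟩ b ⟨b1, b2, b3⟩
        exact ⟨⟨fun m hm => a1 _ (hM21 (b1 m hm)), fun m hm => hT 2 3 (by norm_num) (a3 _ (b2 m hm)),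
          fun m hm => a3 _ (hT 2 3 (by norm_num) (b3 m hm))⟩, fun m hm => a3 _ (b2 m hm)⟩)
      (ev '' S1 1) (ev '' S1 2) (Set.image_mono hS21)
      (by rintro U ⟨hU, -⟩ m hm; exact hU m hm)
      (by rintro _ ⟨w, hw, rfl⟩; exact hLA w hw)
      (by rintro _ ⟨w, hw, rfl⟩; exact ⟨hLA w (hS21 hw), hLT 2 1 w hw⟩)
    have hW1 : W1 ∈ S1 1 := ⟨wLen_pos W1, fun c hc => hc⟩
    have hW1M : ev W1 ∈ M := Submodule.subset_span ⟨_, hW1, rfl⟩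
    have hr1M : r1 ∈ M2 := by
      refine Submodule.span_mono (Set.image_mono ?_) hr1
      rintro v ⟨h1, h2, h3, h4⟩
      exact ⟨le_trans (by norm_num) h1, h4⟩
    have hr2T : r2 ∈ T 3 := by
      refine Submodule.span_mono (Set.image_mono ?_) hr2
      rintro v ⟨h1, h2, h3, h4⟩
      exact ⟨h1, h2, h3, fun c hc => List.mem_append_right _ (h4 c hc)⟩
    have hW2T : ev W2 ∈ T 1 := by
      refine Submodule.subset_span ⟨_, ⟨wLen_pos W2, rfl, ?_, ?_⟩, rfl⟩
      · rw [wCount_eq]; exact List.count_eq_one_of_mem hnd2 (wLast_mem W2)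
      · exact fun c hc => List.mem_append_right _ hc
    obtain ⟨v, hv, hve⟩ : ∃ v ∈ VV, L (π y1) = p ^ t • L (ev W1) + p ^ (t + 1) • v := by
      have c1 := (hcore t).1 (ev W1) ⟨W1, hW1, rfl⟩
      have c2 := (hcore t).2.1 (ev W1) hW1M (p • r1) (nsmul_mem (hM21 hr1M) p)
      have c3 := (hcore (t + 1)).2.2.2 r1 hr1M
      have e1 : p ^ t • p • r1 = p ^ (t + 1) • r1 := by rw [smul_smul, ← pow_succ]
      rw [e1] at c2
      rw [← hπ1] at c2
      obtain ⟨v, hv, hve⟩ := mem_PS.1 (Submodule.add_mem _ (Submodule.add_mem _ c2 c1) c3)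
      refine ⟨v, hv, ?_⟩
      rw [← hve]; abel
    obtain ⟨c, hc⟩ := H2 y1 (wEval star (fun k => p ^ i k • x k) W2)
    have hπc : π c = p ^ (t + s2) • ev (W1 * W2)
        + p ^ (t + s2 + 1) • (L (ev W1) r2 + v (ev W2) + p • v r2) := by
      rw [← H3 _ _ _ hc, ← hLa, hve, hπ2, hevm]
      simp only [LinearMap.add_apply, LinearMap.smul_apply, map_add, map_nsmul, smul_add, smul_smul]
      have q1 : p ^ t * p ^ s2 = p ^ (t + s2) := by ring
      have q2 : p ^ t * p ^ (s2 + 1) = p ^ (t + s2 + 1) := by ring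
      have q3 : p ^ (t + 1) * p ^ s2 = p ^ (t + s2 + 1) := by ring
      have q4 : p ^ (t + 1) * p ^ (s2 + 1) = p ^ (t + s2 + 1) * p := by ring
      have q1' : p ^ s2 * p ^ t = p ^ (t + s2) := by ring
      have q2' : p ^ (s2 + 1) * p ^ t = p ^ (t + s2 + 1) := by ring
      have q3' : p ^ s2 * p ^ (t + 1) = p ^ (t + s2 + 1) := by ring
      have q4' : p ^ (s2 + 1) * p ^ (t + 1) = p ^ (t + s2 + 1) * p := by ring
      simp only [q1, q2, q3, q4, q1', q2', q3', q4']
      abel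
    have hrT : L (ev W1) r2 + v (ev W2) + p • v r2 ∈ T 3 := by
      refine Submodule.add_mem _ (Submodule.add_mem _ ?_ (hv.2 _ hW2T)) (nsmul_mem ?_ p)
      · exact (hLA W1 hW1).2.2 _ (hT 2 3 (by norm_num) hr2T)
      · exact hv.2 _ (hT 1 3 (by norm_num) hr2T)
    have hsum : (l.map i).sum = t + s2 + 1 := by
      rw [hl, List.map_append, List.sum_append, ht, ← hs2]; omega
    have hpc : p • c = wEval star (fun k => p ^ i k • x k) (W1 * W2) := by
      rw [hc, hy1]; rfl
    rw [hsum]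
    refine ⟨⟨_, hrT, ?_⟩, fun _ => ⟨c, hpc, _, hrT, hπc⟩⟩
    rw [← hpc, map_nsmul, hπc, smul_add, smul_smul, smul_smul, ← pow_succ', ← pow_succ']

theorem wEval_pi {α Ω β : Type*} (op : (Ω → β) → (Ω → β) → (Ω → β)) (op' : Ω → β → β → β)
    (hop : ∀ a b ω, op a b ω = op' ω (a ω) (b ω)) (f : α → Ω → β) (w : FreeMagma α) (ω : Ω) :
    wEval op f w ω = wEval (op' ω) (fun k => f k ω) w := by
  induction w with
  | ih1 a => rfl
  | ih2 u v hu hv =>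
    change op (wEval op f u) (wEval op f v) ω = op' ω _ _
    rw [hop, hu, hv]

/-- for a word `W` in `X_1,…,X_j` (each occurring once, in order) and
exponents `i_1,…,i_{j−1} > 0`, `i_j ≥ 0`, there are integers `β_v` (finitely many nonzero,
depending only on `(A,+)`, `W` and the `i_k`), indexed by words of length `> 2` in which
`X_j` occurs exactly once, at the end, such that for every brace with additive group
`(A,+)`: `[℘⁻¹(W{p^{i_1}x_1,…,p^{i_j}x_j})]
  = p^{i_1+⋯+i_j−1}·W⟨[x_1],…,[x_j]⟩ + p^{i_1+⋯+i_j}·Σ_v β_v·v⟨[x_1],…,[x_j]⟩`,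
where `W{…}` is evaluated under `*` and `⟨…⟩` under `⊙`. -/
theorem stmt_3 (p n : ℕ) (hp : p.Prime) (hn : n < p - 1)
    (A : Type u) [AddCommGroup A] (hcard : Nat.card A = p ^ n)
    (j : ℕ) (hj : 2 ≤ j)
    (W : FreeMagma (Fin j)) (hW : wLeaves W = List.finRange j)
    (i : Fin j → ℕ) (hi : ∀ k : Fin j, (k : ℕ) + 1 < j → 0 < i k) :
    ∃ (S : Finset (FreeMagma (Fin j))) (β : FreeMagma (Fin j) → ℤ),
      (∀ v ∈ S, 2 < wLen v ∧ wLast v = (⟨j - 1, by omega⟩ : Fin j) ∧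
        wCount (⟨j - 1, by omega⟩ : Fin j) v = 1) ∧
      ∀ (B : LeftBrace A)
        (odot : (A ⧸ annSub A (p ^ 2)) → (A ⧸ annSub A (p ^ 2)) → (A ⧸ annSub A (p ^ 2))),
        (∀ a b c : A, p • c = B.star (p • a) b →
          odot (qmk (p ^ 2) a) (qmk (p ^ 2) b) = qmk (p ^ 2) c) →
        ∀ (x : Fin j → A) (y : A),
          p • y = wEval B.star (fun k => p ^ (i k) • x k) W →
          qmk (p ^ 2) y =
            p ^ ((∑ k, i k) - 1) • wEval odot (fun k => qmk (p ^ 2) (x k)) W +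
              p ^ (∑ k, i k) •
                ∑ v ∈ S, β v • wEval odot (fun k => qmk (p ^ 2) (x k)) v := by
  classical
  let Q := A ⧸ annSub A (p ^ 2)
  let Ω := {ω : (LeftBrace A × (Q → Q → Q)) × ((Fin j → A) × A) //
    (∀ a b c : A, p • c = ω.1.1.star (p • a) b →
          ω.1.2 (qmk (p ^ 2) a) (qmk (p ^ 2) b) = qmk (p ^ 2) c) ∧
    p • ω.2.2 = wEval ω.1.1.star (fun k => p ^ (i k) • ω.2.1 k) W}
  let π : (Ω → A) →+ (Ω → Q) :=
    { toFun := fun f ω => qmk (p ^ 2) (f ω)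
      map_zero' := rfl
      map_add' := fun _ _ => rfl }
  let star : (Ω → A) → (Ω → A) → (Ω → A) := fun f g ω => ω.1.1.1.star (f ω) (g ω)
  let odot : (Ω → Q) → (Ω → Q) → (Ω → Q) := fun f g ω => ω.1.1.2 (f ω) (g ω)
  have hA : ∀ a : A, p ^ n • a = 0 := fun a => by rw [← hcard]; exact card_nsmul_eq_zero'
  have hlast : wLast W = (⟨j - 1, by omega⟩ : Fin j) := by
    have h1 := wLast_getLast W
    rw [hW, List.getLast?_eq_getElem?] at h1
    have h2 : j - 1 < j := by omega
    simp [h2] at h1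
    exact h1.symm
  have main := words_main p n hp hn.le π
    (fun f => ⟨fun ω => Quotient.out (f ω), funext fun ω => Quotient.out_eq (f ω)⟩) star odot
    (fun f => funext fun ω => by
      obtain ⟨a, ha⟩ := QuotientAddGroup.mk_surjective (f ω)
      change p ^ n • f ω = 0
      rw [← ha, ← QuotientAddGroup.mk_nsmul, hA]; rfl)
    (fun f g h => funext fun ω => ω.1.1.1.star_add _ _ _)
    (fun f g => by
      choose c hc using fun ω : Ω => ω.1.1.1.star_dvd hp hn hcard (f ω) (g ω)
      exact ⟨c, funext hc⟩)
    (fun f g h hh => funext fun ω => ω.2.1 _ _ _ (congrFun hh ω))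
    (fun f g h => funext fun ω => by
      have h1 : p • f ω = p • g ω := congrFun h ω
      refine QuotientAddGroup.eq.2 ?_
      change p ^ 2 • (-f ω + g ω) = 0
      rw [pow_two, mul_smul, smul_add, smul_neg, h1, neg_add_cancel, smul_zero])
    (fun u v b => funext fun ω => ω.1.1.1.star_circ _ _ _)
    (fun b => funext fun ω => ω.1.1.1.zero_star _)
    (fun k ω => ω.1.2.1 k) i W (by rw [hW]; exact List.nodup_finRange j)
    (fun k _ hk => hi k (by
      rw [hlast] at hk
      have h1 : (k : ℕ) ≠ j - 1 := fun h => hk (Fin.ext h)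
      have := k.2
      omega))
  have hlen : 1 < wLen W := by
    have hll : ∀ w : FreeMagma (Fin j), wLen w = (wLeaves w).length := by
      intro w
      induction w with
      | ih1 a => rfl
      | ih2 u v hu hv =>
        change wLen u + wLen v = (wLeaves u ++ wLeaves v).length
        rw [List.length_append, hu, hv]
    rw [hll, hW, List.length_finRange]; omega
  obtain ⟨y0, hy0, r, hr, hyr⟩ := main.2 (Or.inr hlen)
  rw [Finsupp.mem_span_image_iff_linearCombination] at hr
  obtain ⟨l, hl, rfl⟩ := hr
  have hsum : ((wLeaves W).map i).sum = ∑ k, i k := by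
    rw [hW, Fin.sum_univ_def]
  rw [hsum] at hyr
  refine ⟨l.support, l, ?_, ?_⟩
  · intro v hv
    obtain ⟨h1, h2, h3, -⟩ := (Finsupp.mem_supported _ _).1 hl hv
    rw [hlast] at h2 h3
    exact ⟨h1, h2, h3⟩
  · intro B od hod x y hy
    let ω : Ω := ⟨((B, od), (x, y)), hod, hy⟩
    have hpt : ∀ w : FreeMagma (Fin j),
        wEval odot (fun k => π (fun ω => ω.1.2.1 k)) w ω
          = wEval od (fun k => qmk (p ^ 2) (x k)) w := fun w =>
      wEval_pi odot (fun ω => ω.1.1.2) (fun _ _ _ => rfl) _ w ω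
    have hst : wEval star (fun k => p ^ i k • fun ω : Ω => ω.1.2.1 k) W ω
        = wEval B.star (fun k => p ^ i k • x k) W :=
      wEval_pi star (fun ω => ω.1.1.1.star) (fun _ _ _ => rfl) _ W ω
    have h1 : p • y0 ω = p • y := by
      rw [hy, ← hst, ← hy0]; rfl
    have h2 : qmk (p ^ 2) y = qmk (p ^ 2) (y0 ω) := by
      refine QuotientAddGroup.eq.2 ?_
      change p ^ 2 • (-y + y0 ω) = 0
      rw [pow_two, mul_smul, smul_add, smul_neg, h1, neg_add_cancel, smul_zero]
    have h3 := congrFun hyr ω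
    rw [h2]
    refine h3.trans ?_
    rw [Finsupp.linearCombination_apply, Finsupp.sum]
    rw [Pi.add_apply, Pi.smul_apply, Pi.smul_apply, Finset.sum_apply, hpt]
    congr 2
    refine Finset.sum_congr rfl (fun v _ => ?_)
    rw [Pi.smul_apply, hpt]
end

section
/- Let p be a prime number and (A,+,∘) a left brace of cardinality p^n with p > n+1. For a ∈ A let f^{(1)}(a) = f(a) and f^{(i+1)}(a) = f(f^{(i)}(a)), set g(a) = f^{(p^p!−1)}(a), and let g^{(i)} denote the i-fold iterate of g. Then [f(g(a))] = [g(f(a))] = [a] in A/ann(p^2), and [f(a)] = [g^{(p^p!−1)}(a)] in A/ann(p^2). -/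
universe u

namespace BraceAux

open Polynomial

/-- The polynomial `Σ_{i<p-1} (C(p-1,i)/(i+1)) X^i`. -/
noncomputable def Phi (p : ℕ) : ℤ[X] :=
  ∑ i ∈ Finset.range (p - 1), ((Nat.choose (p - 1) i / (i + 1) : ℕ) : ℤ[X]) * X ^ i

theorem choose_div (p : ℕ) (hp : p.Prime) (i : ℕ) (hi : i < p - 1) :
    p * (Nat.choose (p - 1) i / (i + 1)) = Nat.choose p (i + 1) := by
  obtain ⟨q, rfl⟩ : ∃ q, p = q + 1 := ⟨p - 1, by have := hp.pos; omega⟩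
  have h := Nat.add_one_mul_choose_eq q i
  simp only [Nat.add_sub_cancel] at *
  have hc : Nat.Coprime (i + 1) (q + 1) :=
    (Nat.coprime_of_lt_prime (Nat.succ_ne_zero i) (by omega) hp).symm
  have hd : (i + 1) ∣ Nat.choose q i := by
    apply hc.dvd_of_dvd_mul_left
    rw [h]; exact Dvd.intro_left _ rfl
  obtain ⟨c, hcc⟩ := hd
  rw [hcc, Nat.mul_div_cancel_left _ (Nat.succ_pos i)]
  apply Nat.eq_of_mul_eq_mul_right (Nat.succ_pos i)
  rw [Nat.succ_eq_add_one, ← h, hcc]; ring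

theorem pow_identity (p : ℕ) (hp : p.Prime) :
    ((1 : ℤ[X]) + X) ^ p = 1 + (p : ℤ[X]) * (X * Phi p) + X ^ p := by
  obtain ⟨q, hq⟩ : ∃ q, p = q + 1 := ⟨p - 1, by have := hp.pos; omega⟩
  rw [add_comm, add_pow, Finset.sum_range_succ]
  conv_lhs => rw [hq]
  rw [Finset.sum_range_succ']
  rw [← hq]
  simp only [one_pow, mul_one, Nat.choose_self, Nat.choose_zero_right, pow_zero, Nat.cast_one]
  have : ∑ k ∈ Finset.range q, (X : ℤ[X]) ^ (k + 1) * ((p.choose (k + 1) : ℕ) : ℤ[X])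
      = (p : ℤ[X]) * (X * Phi p) := by
    unfold Phi
    rw [show p - 1 = q by omega, Finset.mul_sum, Finset.mul_sum]
    apply Finset.sum_congr rfl
    intro i hi
    have := choose_div p hp i (by have := Finset.mem_range.1 hi; omega)
    rw [← this, show p - 1 = q by omega]
    push_cast; ring
  rw [this]; ring

theorem geom_identity (p : ℕ) (hp : p.Prime) :
    ∑ i ∈ Finset.range p, ((1 : ℤ[X]) + X) ^ i = (p : ℤ[X]) * Phi p + X ^ (p - 1) := by
  have h := mul_geom_sum ((1 : ℤ[X]) + X) p
  rw [pow_identity p hp] at h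
  have hx : (X : ℤ[X]) ^ p = X * X ^ (p - 1) := by
    rw [← pow_succ', Nat.sub_add_cancel hp.pos]
  apply mul_left_cancel₀ (X_ne_zero (R := ℤ))
  rw [add_sub_cancel_left] at h
  rw [h, hx]; ring

theorem Phi_coeff_zero (p : ℕ) (hp : p.Prime) : (Phi p).coeff 0 = 1 := by
  have h2 := hp.two_le
  obtain ⟨q, hq⟩ : ∃ q, p - 1 = q + 1 := ⟨p - 2, by omega⟩
  rw [coeff_zero_eq_eval_zero]
  unfold Phi
  rw [hq, Finset.sum_range_succ']
  simp [eval_finsetSum]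

theorem aeval_congr {R : Type*} [Ring R] (p : ℕ) (x y : R) (k : ℕ)
    (h : ∀ j, k ≤ j → (p : R) * x ^ j = (p : R) * y ^ j) (P : ℤ[X]) :
    (p : R) * aeval x (X ^ k * P) = (p : R) * aeval y (X ^ k * P) := by
  induction P using Polynomial.induction_on' with
  | add f g hf hg => simp only [mul_add, map_add, hf, hg]
  | monomial n c =>
    rw [← C_mul_X_pow_eq_monomial]
    have : (X : ℤ[X]) ^ k * (C c * X ^ n) = c • (X ^ (k + n)) := by
      rw [zsmul_eq_mul, pow_add]; simp only [eq_intCast]; ring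
    rw [this]
    simp only [map_zsmul, map_pow, aeval_X, mul_smul_comm]
    rw [h _ (by omega)]

theorem exists_one_add (P : ℤ[X]) (h : P.coeff 0 = 1) : ∃ Q : ℤ[X], P = 1 + X * Q := by
  have : (X : ℤ[X]) ∣ P - 1 := by
    rw [X_dvd_iff]; simp [h]
  obtain ⟨Q, hQ⟩ := this
  exact ⟨Q, by rw [← hQ]; ring⟩

theorem pmul_pow {R : Type*} [Ring R] (p : ℕ) (s t : R)
    (h : (p : R) * s = (p : R) * t) (k : ℕ) : (p : R) * s ^ k = (p : R) * t ^ k := by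
  induction k with
  | zero => simp
  | succ k ih =>
    rw [pow_succ, ← mul_assoc, ih, (Nat.cast_commute p (t ^ k)).eq, mul_assoc, h,
      ← mul_assoc, ← (Nat.cast_commute p (t ^ k)).eq, mul_assoc, ← pow_succ]

theorem key {R : Type*} [Ring R] (p m : ℕ) (x y : R) (hx : x ^ m = 0) (hy : y ^ m = 0)
    (F : ℤ[X]) (hF : F.coeff 0 = 1)
    (h : (p : R) * aeval x (X * F) = (p : R) * aeval y (X * F)) :
    ∀ j : ℕ, (p : R) * x ^ j = (p : R) * y ^ j := by
  have main : ∀ d k, m ≤ k + d → ∀ j, k ≤ j → (p : R) * x ^ j = (p : R) * y ^ j := by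
    intro d
    induction d with
    | zero =>
      intro k hk j hj
      rw [pow_eq_zero_of_le (by omega) hx, pow_eq_zero_of_le (by omega) hy]
    | succ d ih =>
      intro k hk j hj
      have hrec := ih (j + 1) (by omega)
      obtain ⟨Q, hQ⟩ := exists_one_add (F ^ j) (by
        rw [coeff_zero_eq_eval_zero] at hF ⊢; simp [hF])
      have e : (X : ℤ[X]) ^ j = (X * F) ^ j - X ^ (j + 1) * Q := by
        rw [mul_pow, hQ]; ring
      have h1 := aeval_congr p x y (j + 1) hrec Q
      have h2 := pmul_pow p _ _ h j
      have ex : x ^ j = aeval x ((X : ℤ[X]) ^ j) := by simp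
      have ey : y ^ j = aeval y ((X : ℤ[X]) ^ j) := by simp
      rw [ex, ey, e, map_sub, map_sub, mul_sub, mul_sub, h1, map_pow, map_pow, h2]
  intro j
  exact main m 0 (by omega) j (by omega)

section Brace

variable {A : Type u} [AddCommGroup A] (B : LeftBrace A)

theorem circ_zero (a : A) : B.circ a 0 = a := by
  have h := B.circ_add a 0 0
  rw [add_zero] at h
  exact (add_left_cancel h).symm

theorem one_eq : B.one = 0 := by
  rw [← circ_zero B B.one, B.one_circ]

/-- The map `λ_a`. -/
def lam (a : A) : AddMonoid.End A :=
  AddMonoidHom.mk' (fun b => B.circ a b - a) (by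
    intro b c
    have h := B.circ_add a b c
    have h2 : B.circ a (b + c) = B.circ a b + B.circ a c - a := by rw [← h]; abel
    rw [h2]; abel)

theorem lam_apply (a b : A) : lam B a b = B.circ a b - a := rfl

theorem lam_circ (a b : A) : lam B (B.circ a b) = lam B a * lam B b := by
  ext c
  show lam B (B.circ a b) c = lam B a (lam B b c)
  rw [lam_apply B b c, map_sub, lam_apply, lam_apply, lam_apply, B.circ_assoc]
  abel

theorem lam_zero : lam B 0 = 1 := by
  ext c
  show lam B 0 c = c
  rw [lam_apply, ← one_eq B, B.one_circ, one_eq B, sub_zero]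

/-- `λ_a - 1`. -/
def xi (a : A) : AddMonoid.End A := lam B a - 1

theorem lam_eq (a : A) : lam B a = 1 + xi B a := by unfold xi; abel

theorem star_eq (a b : A) : B.star a b = xi B a b := by
  show _ = lam B a b - b
  rw [lam_apply]; rfl

theorem eSeq_eq (a : A) (i : ℕ) : eSeq B a i = (xi B a ^ i) a := by
  induction i with
  | zero => rfl
  | succ i ih =>
    rw [pow_succ']
    show B.star a (eSeq B a i) = xi B a ((xi B a ^ i) a)
    rw [ih, star_eq]

theorem fMap_eq (p : ℕ) (a : A) : fMap B p a = (aeval (xi B a) (Phi p)) a := by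
  have hsum : ∀ (s : Finset ℕ) (g : ℕ → AddMonoid.End A), (∑ i ∈ s, g i) a = ∑ i ∈ s, g i a :=
    fun s g => map_sum (AddMonoidHom.eval a : AddMonoid.End A →+ A) g s
  unfold fMap Phi
  rw [map_sum, hsum]
  symm
  refine Finset.sum_bij (fun i _ => i + 1) ?_ ?_ ?_ ?_
  · intro i hi
    simp only [Finset.mem_range, Finset.mem_Icc] at *
    omega
  · intro i _ j _ h
    omega
  · intro i hi
    simp only [Finset.mem_Icc] at hi
    exact ⟨i - 1, Finset.mem_range.2 (by omega), by omega⟩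
  · intro i _
    rw [map_mul, map_natCast, map_pow, aeval_X, Nat.add_sub_cancel, eSeq_eq]
    show ((Nat.choose (p - 1) i / (i + 1) : ℕ) : AddMonoid.End A) ((xi B a ^ i) a) = _
    simp

theorem lam_circPow (a : A) (k : ℕ) : lam B (circPow B a k) = lam B a ^ k := by
  induction k with
  | zero => rw [pow_zero, ← lam_zero B, ← one_eq B]; rfl
  | succ k ih => rw [pow_succ', ← ih, ← lam_circ]; rfl

theorem circPow_eq (a : A) (k : ℕ) :
    circPow B a k = (∑ i ∈ Finset.range k, lam B a ^ i) a := by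
  induction k with
  | zero => exact one_eq B
  | succ k ih =>
    have h : circPow B a (k + 1) = a + lam B a (circPow B a k) := by
      rw [lam_apply]; show B.circ _ _ = _; abel
    rw [h, ih, geom_sum_succ]
    show _ = (lam B a * _) a + a
    rw [add_comm]; rfl

theorem circPow_card (a : A) : circPow B a (Nat.card A) = 0 := by
  let G : Group A :=
    { mul := B.circ, one := B.one, inv := B.inv, mul_assoc := B.circ_assoc,
      one_mul := B.one_circ, mul_one := B.circ_one, inv_mul_cancel := B.inv_circ }
  have h : ∀ k : ℕ, circPow B a k = a ^ k := by
    intro k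
    induction k with
    | zero => rw [pow_zero]; rfl
    | succ k ih => rw [pow_succ', ← ih]; rfl
  rw [h, pow_card_eq_one', ← one_eq B]; rfl

end Brace

/-- A nilpotent endomorphism of a group of order `p^n` has nilpotency index at most `n`. -/
theorem nil_index {A : Type u} [AddCommGroup A] (p n : ℕ) (hp : p.Prime)
    (hcard : Nat.card A = p ^ n) (x : AddMonoid.End A) (hx : IsNilpotent x) : x ^ n = 0 := by
  have hfin : Finite A := Nat.finite_of_card_ne_zero (by rw [hcard]; exact (pow_pos hp.pos n).ne')
  obtain ⟨N, hN⟩ := hx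
  let I : ℕ → AddSubgroup A := fun k => AddMonoidHom.range (x ^ k : AddMonoid.End A)
  have hmap : ∀ k, I (k + 1) = (I k).map x := by
    intro k
    ext z
    constructor
    · rintro ⟨w, rfl⟩
      exact ⟨(x ^ k) w, ⟨w, rfl⟩, by rw [pow_succ']; rfl⟩
    · rintro ⟨_, ⟨w, rfl⟩, rfl⟩
      exact ⟨w, by rw [pow_succ']; rfl⟩
  have hle : ∀ k, I (k + 1) ≤ I k := by
    rintro k _ ⟨w, rfl⟩
    exact ⟨x w, by rw [pow_succ]; rfl⟩
  have hstab : ∀ k, I (k + 1) = I k → I k = ⊥ := by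
    intro k hk
    have : ∀ d, I (k + d) = I k := by
      intro d
      induction d with
      | zero => rfl
      | succ d ih => rw [← add_assoc, hmap, ih, ← hmap, hk]
    rw [← this N, eq_bot_iff]
    rintro _ ⟨w, rfl⟩
    rw [pow_add, hN, mul_zero]; rfl
  have hdvd : ∀ k, k ≤ n → I k = ⊥ ∨ Nat.card (I k) ∣ p ^ (n - k) := by
    intro k
    induction k with
    | zero =>
      intro _; right
      rw [Nat.sub_zero, ← hcard]
      exact AddSubgroup.card_addSubgroup_dvd_card _
    | succ k ih =>
      intro hk
      rcases ih (by omega) with h | h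
      · left; rw [eq_bot_iff, ← h]; exact hle k
      · by_cases he : I (k + 1) = I k
        · left; rw [he]; exact hstab k he
        · right
          have hd : Nat.card (I (k + 1)) ∣ Nat.card (I k) := AddSubgroup.card_dvd_of_le (hle k)
          obtain ⟨s, hs, hs2⟩ := (Nat.dvd_prime_pow hp).1 h
          rw [hs2] at hd
          obtain ⟨t, ht, ht2⟩ := (Nat.dvd_prime_pow hp).1 hd
          have hne : t ≠ s := by
            rintro rfl
            exact he (AddSubgroup.eq_of_le_of_card_ge (hle k) (by rw [hs2, ht2]))
          rw [ht2]
          exact pow_dvd_pow _ (by omega)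
  have hbot : I n = ⊥ := by
    rcases hdvd n le_rfl with h | h
    · exact h
    · rw [Nat.sub_self, pow_zero, Nat.dvd_one] at h
      exact AddSubgroup.eq_bot_of_card_eq _ h
  ext z
  have : (x ^ n) z ∈ I n := ⟨z, rfl⟩
  rw [hbot] at this
  exact this

section Main

variable {A : Type u} [AddCommGroup A] (B : LeftBrace A)

theorem natCast_apply (k : ℕ) (x : AddMonoid.End A) (z : A) :
    ((k : AddMonoid.End A) * x) z = k • x z := by
  show (k : AddMonoid.End A) (x z) = _
  simp

theorem natCast_apply' (k : ℕ) (x : AddMonoid.End A) (z : A) :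
    ((k : AddMonoid.End A) * x) z = x (k • z) := by
  rw [natCast_apply, map_nsmul]

theorem xi_nilp (p n : ℕ) (hp : p.Prime) (hcard : Nat.card A = p ^ n) (a : A) :
    IsNilpotent (xi B a) := by
  have h1 : lam B a ^ (p ^ n) = 1 := by
    rw [← hcard, ← lam_circPow, circPow_card, lam_zero]
  have hk : ((p : AddMonoid.End A)) ^ n = 0 := by
    ext z
    rw [← Nat.cast_pow, ← mul_one (((p ^ n : ℕ) : AddMonoid.End A)), natCast_apply, ← hcard]
    exact card_nsmul_eq_zero'
  obtain ⟨r, hr⟩ : ∃ r : ℤ[X], ((1 : ℤ[X]) + X) ^ (p ^ n) = 1 ^ (p ^ n) + X ^ (p ^ n) + (p : ℤ[X]) * r := by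
    obtain ⟨r, hr⟩ := exists_add_pow_prime_pow_eq hp (1 : ℤ[X]) X n
    exact ⟨1 * X * r, by rw [hr]; ring⟩
  have h2 := congrArg (aeval (xi B a)) hr
  simp only [map_add, map_pow, map_one, aeval_X, map_mul, one_pow, map_natCast] at h2
  rw [← lam_eq, h1] at h2
  have h3 : xi B a ^ (p ^ n) = (p : AddMonoid.End A) * aeval (xi B a) (-r) := by
    rw [map_neg, mul_neg, eq_neg_iff_add_eq_zero]
    have := h2
    rw [add_assoc] at this
    exact (left_eq_add.1 this)
  refine ⟨p ^ n * n, ?_⟩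
  rw [pow_mul, h3, (Nat.cast_commute p _).mul_pow, hk, zero_mul]


theorem xi_pow (p n : ℕ) (hp : p.Prime) (hpn : n + 1 < p) (hcard : Nat.card A = p ^ n) (a : A) :
    xi B a ^ (p - 1) = 0 :=
  pow_eq_zero_of_le (by omega) (nil_index p n hp hcard _ (xi_nilp B p n hp hcard a))

theorem circPow_p (p n : ℕ) (hp : p.Prime) (hpn : n + 1 < p) (hcard : Nat.card A = p ^ n)
    (a : A) : circPow B a p = p • fMap B p a := by
  have h := congrArg (aeval (xi B a)) (geom_identity p hp)
  simp only [map_add, map_sum, map_pow, map_one, aeval_X, map_mul, map_natCast] at h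
  rw [← lam_eq, xi_pow B p n hp hpn hcard, add_zero] at h
  rw [circPow_eq, h, natCast_apply, fMap_eq]

theorem lam_pow_p (p n : ℕ) (hp : p.Prime) (hpn : n + 1 < p) (hcard : Nat.card A = p ^ n)
    (a : A) : lam B a ^ p = 1 + (p : AddMonoid.End A) * aeval (xi B a) (X * Phi p) := by
  have h := congrArg (aeval (xi B a)) (pow_identity p hp)
  simp only [map_add, map_pow, map_one, aeval_X, map_mul, map_natCast] at h
  rw [← lam_eq, pow_eq_zero_of_le (by omega) (xi_pow B p n hp hpn hcard a), add_zero] at h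
  rw [h]; simp

theorem agree (p n : ℕ) (hp : p.Prime) (hpn : n + 1 < p) (hcard : Nat.card A = p ^ n)
    (a b : A) (h : circPow B a p = circPow B b p) (j : ℕ) :
    (p : AddMonoid.End A) * xi B a ^ j = (p : AddMonoid.End A) * xi B b ^ j := by
  refine key p (p - 1) _ _ (xi_pow B p n hp hpn hcard a) (xi_pow B p n hp hpn hcard b)
    (Phi p) (Phi_coeff_zero p hp) ?_ j
  have h1 : lam B a ^ p = lam B b ^ p := by rw [← lam_circPow, h, lam_circPow]
  rw [lam_pow_p B p n hp hpn hcard, lam_pow_p B p n hp hpn hcard] at h1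
  exact add_left_cancel h1

theorem agree_Phi (p : ℕ) (a b : A)
    (h : ∀ j : ℕ, (p : AddMonoid.End A) * xi B a ^ j = (p : AddMonoid.End A) * xi B b ^ j) :
    (p : AddMonoid.End A) * aeval (xi B a) (Phi p)
      = (p : AddMonoid.End A) * aeval (xi B b) (Phi p) := by
  have := aeval_congr p (xi B a) (xi B b) 0 (fun j _ => h j) (Phi p)
  simpa using this

theorem f_inj (p n : ℕ) (hp : p.Prime) (hpn : n + 1 < p) (hcard : Nat.card A = p ^ n)
    (a b : A) (h : p • fMap B p a = p • fMap B p b) : p • a = p • b := by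
  have h1 := agree_Phi B p a b (agree B p n hp hpn hcard a b (by
    rw [circPow_p B p n hp hpn hcard, circPow_p B p n hp hpn hcard, h]))
  have h2 : aeval (xi B a) (Phi p) (p • a) = aeval (xi B a) (Phi p) (p • b) := by
    rw [← natCast_apply', natCast_apply, ← fMap_eq, h, fMap_eq, ← natCast_apply, ← h1,
      natCast_apply']
  obtain ⟨Q, hQ⟩ := exists_one_add _ (Phi_coeff_zero p hp)
  have hu : IsUnit (aeval (xi B a) (Phi p)) := by
    rw [hQ, map_add, map_one, map_mul, aeval_X]
    apply IsNilpotent.isUnit_one_add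
    have hc : Commute (xi B a) (aeval (xi B a) Q) := by
      have := congrArg (aeval (xi B a)) (mul_comm X Q)
      rw [map_mul, map_mul, aeval_X] at this
      exact this
    exact hc.isNilpotent_mul_right (xi_nilp B p n hp hcard a)
  obtain ⟨v, hv⟩ := hu.exists_left_inv
  have h3 := congrArg v h2
  have h4 : ∀ z, v (aeval (xi B a) (Phi p) z) = z := by
    intro z
    show (v * aeval (xi B a) (Phi p)) z = z
    rw [hv]; rfl
  rwa [h4, h4] at h3

theorem f_wd (p n : ℕ) (hp : p.Prime) (hpn : n + 1 < p) (hcard : Nat.card A = p ^ n)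
    (a b : A) (h : p • a = p • b) : p • fMap B p a = p • fMap B p b := by
  have hinv : B.circ a (B.inv a) = B.one := by
    let G : Group A :=
      { mul := B.circ, one := B.one, inv := B.inv, mul_assoc := B.circ_assoc,
        one_mul := B.one_circ, mul_one := B.circ_one, inv_mul_cancel := B.inv_circ }
    exact mul_inv_cancel a
  have hleft : lam B (B.inv a) * lam B a = 1 := by
    rw [← lam_circ, B.inv_circ, one_eq, lam_zero]
  set c := B.circ (B.inv a) b with hc
  have hb : B.circ a c = b := by rw [hc, ← B.circ_assoc, hinv, B.one_circ]
  have hpc : p • c = 0 := by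
    have h1 : lam B a (p • c) = 0 := by
      rw [map_nsmul, lam_apply, hb, smul_sub, h, sub_self]
    have h2 : (lam B (B.inv a) * lam B a) (p • c) = 0 := by
      show lam B (B.inv a) (lam B a (p • c)) = 0
      rw [h1, map_zero]
    rw [hleft] at h2
    exact h2
  have hc0 : circPow B c p = circPow B 0 p := by
    rw [circPow_p B p n hp hpn hcard, fMap_eq, ← map_nsmul, hpc, map_zero, circPow_eq, map_zero]
  have h1 := agree B p n hp hpn hcard c 0 hc0 1
  have h2 : xi B (0 : A) = 0 := by unfold xi; rw [lam_zero, sub_self]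
  rw [h2, pow_one, pow_one, mul_zero] at h1
  have h3 : (p : AddMonoid.End A) * xi B a = (p : AddMonoid.End A) * xi B b := by
    have : xi B b = xi B a + lam B a * xi B c := by
      unfold xi
      rw [← hb, lam_circ, mul_sub, mul_one]; abel
    rw [this, mul_add, ← mul_assoc, (Nat.cast_commute p (lam B a)).eq, mul_assoc, h1, mul_zero,
      add_zero]
  have h4 := agree_Phi B p a b (pmul_pow p _ _ h3)
  rw [fMap_eq, fMap_eq, ← natCast_apply, h4, natCast_apply', h, ← natCast_apply', natCast_apply]

theorem iter_eq (p n : ℕ) (hp : p.Prime) (hpn : n + 1 < p) (hcard : Nat.card A = p ^ n)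
    (a : A) (k : ℕ) (hk : (p ^ p).factorial ∣ k) : p • (fMap B p)^[k] a = p • a := by
  have hfin : Finite A := Nat.finite_of_card_ne_zero (by rw [hcard]; exact (pow_pos hp.pos n).ne')
  let Q := Set.range (fun a : A => p • a)
  let π : A → Q := fun a => ⟨p • a, a, rfl⟩
  have hπ : ∀ x y, π x = π y ↔ p • x = p • y := fun x y => Subtype.ext_iff
  have hsurj : Function.Surjective π := by
    rintro ⟨_, x, rfl⟩; exact ⟨x, rfl⟩
  let F : Q → Q := fun q => π (fMap B p (Function.surjInv hsurj q))
  have hF : ∀ x, π (fMap B p x) = F (π x) := by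
    intro x
    rw [hπ]
    apply f_wd B p n hp hpn hcard
    exact (hπ _ _).1 (Function.surjInv_eq hsurj (π x)).symm
  have hinj : Function.Injective F := by
    intro q r hqr
    obtain ⟨x, rfl⟩ := hsurj q
    obtain ⟨y, rfl⟩ := hsurj r
    rw [← hF, ← hF, hπ] at hqr
    rw [hπ]
    exact f_inj B p n hp hpn hcard x y hqr
  let σ : Equiv.Perm Q := Equiv.ofBijective F (Finite.injective_iff_bijective.1 hinj)
  have hσ : σ ^ k = 1 := by
    apply orderOf_dvd_iff_pow_eq_one.1
    refine (orderOf_dvd_natCard σ).trans (dvd_trans ?_ hk)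
    rw [Nat.card_perm]
    apply Nat.factorial_dvd_factorial
    calc Nat.card Q ≤ Nat.card A := Nat.card_le_card_of_surjective π hsurj
      _ = p ^ n := hcard
      _ ≤ p ^ p := Nat.pow_le_pow_right hp.pos (by omega)
  have hsemi : Function.Semiconj π (fMap B p) F := hF
  have h1 := (hsemi.iterate_right k) a
  rw [← hπ, h1]
  have h2 : F^[k] = ⇑(σ ^ k) := by
    rw [Equiv.Perm.coe_pow]; rfl
  rw [h2, hσ]; rfl

theorem qmk_of (p : ℕ) (x y : A) (h : p • x = p • y) : qmk (p ^ 2) x = qmk (p ^ 2) y := by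
  unfold qmk
  rw [QuotientAddGroup.eq]
  show (p ^ 2) • (-x + y) = 0
  rw [pow_two, mul_smul, smul_add, smul_neg, h, neg_add_cancel, smul_zero]

end Main

end BraceAux

/-- with `g = f^{(p^p!−1)}` (iterate of `f`), one has
`[f(g(a))] = [g(f(a))] = [a]` and `[f(a)] = [g^{(p^p!−1)}(a)]` in `A/ann(p²)`. -/
theorem stmt_8 (p n : ℕ) (hp : p.Prime) (hpn : n + 1 < p)
    (A : Type u) [AddCommGroup A] (B : LeftBrace A) (hcard : Nat.card A = p ^ n)
    (a : A) :
    qmk (p ^ 2) (fMap B p ((fun x => fMap B p x)^[(p ^ p).factorial - 1] a))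
      = qmk (p ^ 2) a ∧
    qmk (p ^ 2) ((fun x => fMap B p x)^[(p ^ p).factorial - 1] (fMap B p a))
      = qmk (p ^ 2) a ∧
    qmk (p ^ 2) (fMap B p a)
      = qmk (p ^ 2)
          (((fun x => fMap B p x)^[(p ^ p).factorial - 1])^[(p ^ p).factorial - 1] a) := by
  have hN : 0 < (p ^ p).factorial := Nat.factorial_pos _
  have hit := BraceAux.iter_eq B p n hp hpn hcard
  refine ⟨?_, ?_, ?_⟩
  · apply BraceAux.qmk_of
    have h := hit a _ dvd_rfl
    rw [← Nat.sub_add_cancel hN, Function.iterate_succ_apply'] at h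
    exact h
  · apply BraceAux.qmk_of
    have h := hit a _ dvd_rfl
    rw [← Nat.sub_add_cancel hN, Function.iterate_succ_apply] at h
    exact h
  · apply BraceAux.qmk_of
    rw [← Function.iterate_mul]
    have hN2 : 2 ≤ (p ^ p).factorial := by
      have h4 : 2 ≤ p ^ p := hp.two_le.trans (Nat.le_self_pow hp.pos.ne' p)
      exact h4.trans (Nat.self_le_factorial _)
    have e : ((p ^ p).factorial - 1) * ((p ^ p).factorial - 1)
        = (p ^ p).factorial * ((p ^ p).factorial - 2) + 1 := by
      obtain ⟨m, hm⟩ : ∃ m, (p ^ p).factorial = m + 2 := ⟨_, (Nat.sub_add_cancel hN2).symm⟩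
      rw [hm, show m + 2 - 1 = m + 1 by omega, show m + 2 - 2 = m by omega]; ring
    rw [e, Function.iterate_succ_apply]
    exact (hit (fMap B p a) _ (Dvd.intro _ rfl)).symm
end
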